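/- (Moments of the solution of the pure fractional SDE.) Let H ∈ (1/2,1), T > 0, and let B^H be a fractional Brownian motion with Hurst parameter H on a probability space (Ω, F, P). Let a, c : [0,T] × ℝ → ℝ satisfy, for some constants M > 0 and β ∈ (1−H,1) and all s,t ∈ [0,T], x,y ∈ ℝ: |a(t,x)| + |c(t,x)| ≤ M(1+|x|), |a(t,x) − a(t,y)| + |c(t,x) − c(t,y)| ≤ M|x−y|, and |a(s,x) − a(t,x)| + |c(s,x) − c(t,x)| ≤ M|s−t|^β. Let X_0 ∈ ℝ, let κ ∈ (1−H, 1), fix α ∈ (1−H, min(κ, β, 1/2)), and let X = (X_t)_{t∈[0,T]} be a stochastic process whose paths are almost surely Hölder continuous of order κ and which satisfies, almost surely, for all t ∈ [0,T], X_t = X_0 + ∫_0^t a(s,X_s) ds + ∫_0^t c(s,X_s) dB^H_s, where the last integral is the pathwise generalized Lebesgue–Stieltjes integral. Then for every p > 0, E[ sup_{t∈[0,T]} |X_t|^p ] < ∞, and moreover E[ ‖X‖_{∞;T}^p ] < ∞. -/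

import Mathlib

open MeasureTheory Set
open scoped ENNReal NNReal

/-- The seminorm `‖g‖_{0;[a,b]}`, valued in `ℝ≥0∞`. -/
noncomputable def zeroNorm (α a b : ℝ) (g : ℝ → ℝ) : ℝ≥0∞ :=
  ⨆ (u : ℝ) (v : ℝ) (_ : a ≤ u) (_ : u < v) (_ : v < b),
    ENNReal.ofReal (|g v - g u| / (v - u) ^ (1 - α)
      + ∫ z in Ioo u v, |g u - g z| / (z - u) ^ (2 - α))

/-- Left-sided fractional derivative `(D^α_{a+} f)(x)`. -/
noncomputable def fracDerivP (α a : ℝ) (f : ℝ → ℝ) (x : ℝ) : ℝ :=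
  (1 / Real.Gamma (1 - α)) *
    (f x / (x - a) ^ α + α * ∫ u in Ioo a x, (f x - f u) / (x - u) ^ (1 + α))

/-- Right-sided fractional derivative `(D^{1-α}_{b-} g_{b-})(x)`. -/
noncomputable def fracDerivM (α b : ℝ) (g : ℝ → ℝ) (x : ℝ) : ℝ :=
  (1 / Real.Gamma α) *
    ((g x - g b) / (b - x) ^ (1 - α) + (1 - α) * ∫ u in Ioo x b, (g x - g u) / (u - x) ^ (2 - α))

/-- Generalized (fractional) Lebesgue–Stieltjes integral `∫_a^b f dg`. -/
noncomputable def glsIntegral (α a b : ℝ) (f g : ℝ → ℝ) : ℝ :=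
  ∫ x in Ioo a b, fracDerivP α a f x * fracDerivM α b g x

/-- `‖X‖_s = ∫_0^s |X_s - X_u| (s-u)^{-1-α} du`, valued in `ℝ≥0∞`. -/
noncomputable def pathNorm (α : ℝ) (X : ℝ → ℝ) (s : ℝ) : ℝ≥0∞ :=
  ∫⁻ u in Ioo (0 : ℝ) s, ENNReal.ofReal (|X s - X u| * (s - u) ^ (-1 - α))

/-- `‖f‖_{∞;T} = sup_{s ≤ T} |f s| + sup_{s ≤ T} ‖f‖_s`, valued in `ℝ≥0∞`. -/
noncomputable def supNorm (α T : ℝ) (f : ℝ → ℝ) : ℝ≥0∞ :=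
  (⨆ (s : ℝ) (_ : s ∈ Set.Icc (0 : ℝ) T), ENNReal.ofReal |f s|) +
    ⨆ (s : ℝ) (_ : s ∈ Set.Icc (0 : ℝ) T), pathNorm α f s

/-- `B` is a fractional Brownian motion with Hurst parameter `H` on `(Ω, P)`:
almost all paths are continuous, every finite linear combination of values is
centered Gaussian, and the covariance is
`E[B_s B_t] = (s^{2H} + t^{2H} - |t-s|^{2H})/2` for `s, t ≥ 0`. -/
def IsFBM {Ω : Type*} [MeasurableSpace Ω] (P : Measure Ω) (H : ℝ)
    (B : Ω → ℝ → ℝ) : Prop :=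
  (∀ᵐ ω ∂P, Continuous (B ω)) ∧
  (∀ (n : ℕ) (c t : Fin n → ℝ), ∃ v : ℝ≥0,
    Measure.map (fun ω => ∑ i, c i * B ω (t i)) P = ProbabilityTheory.gaussianReal 0 v) ∧
  (∀ s t : ℝ, 0 ≤ s → 0 ≤ t
    → (∫ ω, B ω s * B ω t ∂P) = (s ^ (2 * H) + t ^ (2 * H) - |t - s| ^ (2 * H)) / 2)


/-! ### Power integrals -/

lemma pw_left {a b μ : ℝ} (hab : a ≤ b) (hμ : μ < 1) :
    ∫⁻ x in Ioo a b, ENNReal.ofReal ((x - a) ^ (-μ)) = ENNReal.ofReal ((b - a) ^ (1 - μ) / (1 - μ)) := by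
  have hInt : IntervalIntegrable (fun x : ℝ => x ^ (-μ)) volume 0 (b - a) :=
    intervalIntegral.intervalIntegrable_rpow' (by linarith)
  have h1 : IntervalIntegrable (fun x : ℝ => (x - a) ^ (-μ)) volume a b := by
    simpa using hInt.comp_sub_right a
  have h2 : ∫ x in a..b, (x - a) ^ (-μ) = (b - a) ^ (1 - μ) / (1 - μ) := by
    rw [intervalIntegral.integral_comp_sub_right (fun x : ℝ => x ^ (-μ)) a, sub_self,
      integral_rpow (Or.inl (by linarith)), Real.zero_rpow (by linarith)]
    ring_nf
  rw [← h2, intervalIntegral.integral_of_le hab, integral_Ioc_eq_integral_Ioo,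
    ofReal_integral_eq_lintegral_ofReal]
  · exact (h1.1).mono_set Ioo_subset_Ioc_self
  · refine (ae_restrict_iff' measurableSet_Ioo).2 (Filter.Eventually.of_forall fun x hx => ?_)
    exact Real.rpow_nonneg (by linarith [hx.1]) _

lemma pw_right {a b μ : ℝ} (hab : a ≤ b) (hμ : μ < 1) :
    ∫⁻ x in Ioo a b, ENNReal.ofReal ((b - x) ^ (-μ)) = ENNReal.ofReal ((b - a) ^ (1 - μ) / (1 - μ)) := by
  have hInt : IntervalIntegrable (fun x : ℝ => x ^ (-μ)) volume 0 (b - a) :=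
    intervalIntegral.intervalIntegrable_rpow' (by linarith)
  have h1 : IntervalIntegrable (fun x : ℝ => (b - x) ^ (-μ)) volume a b := by
    have := hInt.comp_sub_left b
    simpa using this.symm
  have h2 : ∫ x in a..b, (b - x) ^ (-μ) = (b - a) ^ (1 - μ) / (1 - μ) := by
    rw [intervalIntegral.integral_comp_sub_left (fun x : ℝ => x ^ (-μ)) b, sub_self,
      integral_rpow (Or.inl (by linarith)), Real.zero_rpow (by linarith)]
    ring_nf
  rw [← h2, intervalIntegral.integral_of_le hab, integral_Ioc_eq_integral_Ioo,
    ofReal_integral_eq_lintegral_ofReal]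
  · exact (h1.1).mono_set Ioo_subset_Ioc_self
  · refine (ae_restrict_iff' measurableSet_Ioo).2 (Filter.Eventually.of_forall fun x hx => ?_)
    exact Real.rpow_nonneg (by linarith [hx.2]) _

/-- exponential integral -/
lemma exp_int {lam t : ℝ} (hl : 0 < lam) (ht : 0 ≤ t) :
    ∫⁻ x in Ioo 0 t, ENNReal.ofReal (Real.exp (lam * x)) ≤ ENNReal.ofReal (Real.exp (lam * t) * lam⁻¹) := by
  have hc : Continuous fun x : ℝ => Real.exp (lam * x) := by fun_prop
  rw [← ofReal_integral_eq_lintegral_ofReal]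
  · apply ENNReal.ofReal_le_ofReal
    rw [← integral_Ioc_eq_integral_Ioo, ← intervalIntegral.integral_of_le ht,
      intervalIntegral.integral_comp_mul_left (fun x => Real.exp x) hl.ne', integral_exp]
    simp only [smul_eq_mul, mul_zero, Real.exp_zero]
    rw [mul_comm]
    gcongr
    linarith
  · exact (hc.integrableOn_Icc (a := 0) (b := t)).mono_set Ioo_subset_Icc_self
  · exact Filter.Eventually.of_forall fun x => (Real.exp_pos _).le

/-- `∫_0^x (t-s)^{-1-α} ds ≤ (t-x)^{-α}/α` -/
lemma pw_tail {α t x : ℝ} (hα : 0 < α) (hx : 0 ≤ x) (hxt : x < t) :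
    ∫⁻ s in Ioo 0 x, ENNReal.ofReal ((t - s) ^ (-1 - α)) ≤ ENNReal.ofReal ((t - x) ^ (-α) / α) := by
  have hc : ContinuousOn (fun s : ℝ => (t - s) ^ (-1 - α)) (Icc 0 x) := by
    intro s hs
    apply ContinuousAt.continuousWithinAt
    apply ContinuousAt.rpow_const (by fun_prop)
    left
    have := hs.2
    intro h
    linarith
  rw [← ofReal_integral_eq_lintegral_ofReal]
  · apply ENNReal.ofReal_le_ofReal
    rw [← integral_Ioc_eq_integral_Ioo, ← intervalIntegral.integral_of_le hx,
      intervalIntegral.integral_comp_sub_left (fun x : ℝ => x ^ (-1 - α)) t, integral_rpow]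
    · have e : -1 - α + 1 = -α := by ring
      rw [e, div_neg, ← neg_div, neg_sub]
      gcongr
      have : 0 ≤ (t - 0) ^ (-α) := Real.rpow_nonneg (by linarith) _
      linarith
    · right
      refine ⟨by linarith, ?_⟩
      rw [uIcc_of_le (by linarith)]
      intro h
      linarith [h.1]
  · exact (hc.integrableOn_Icc).mono_set Ioo_subset_Icc_self
  · refine (ae_restrict_iff' measurableSet_Ioo).2 (Filter.Eventually.of_forall fun s hs => ?_)
    exact Real.rpow_nonneg (by linarith [hs.2]) _

/-- Beta-type bound -/
lemma pw_beta {x t μ ν : ℝ} (hxt : x < t) (hμ0 : 0 ≤ μ) (hμ : μ < 1) (hν0 : 0 ≤ ν) (hν : ν < 1) :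
    ∫⁻ s in Ioo x t, ENNReal.ofReal ((t - s) ^ (-μ) * (s - x) ^ (-ν)) ≤
      ENNReal.ofReal ((2 ^ μ / (1 - ν) + 2 ^ ν / (1 - μ)) * (t - x) ^ (1 - μ - ν)) := by
  have hd : 0 < (t - x) / 2 := by linarith
  have hpt : ∀ s ∈ Ioo x t, ENNReal.ofReal ((t - s) ^ (-μ) * (s - x) ^ (-ν)) ≤
      ENNReal.ofReal (((t - x) / 2) ^ (-μ)) * ENNReal.ofReal ((s - x) ^ (-ν)) +
      ENNReal.ofReal (((t - x) / 2) ^ (-ν)) * ENNReal.ofReal ((t - s) ^ (-μ)) := by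
    intro s hs
    have h1 : 0 < t - s := by linarith [hs.2]
    have h2 : 0 < s - x := by linarith [hs.1]
    have a1 := Real.rpow_nonneg h1.le (-μ)
    have a2 := Real.rpow_nonneg h2.le (-ν)
    have b1 := Real.rpow_nonneg hd.le (-μ)
    have b2 := Real.rpow_nonneg hd.le (-ν)
    rw [← ENNReal.ofReal_mul b1, ← ENNReal.ofReal_mul b2, ← ENNReal.ofReal_add (by positivity) (by positivity)]
    apply ENNReal.ofReal_le_ofReal
    rcases le_total ((t - x) / 2) (t - s) with h | h
    · have : (t - s) ^ (-μ) ≤ ((t - x) / 2) ^ (-μ) :=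
        Real.rpow_le_rpow_of_nonpos hd h (by linarith)
      nlinarith [mul_nonneg b2 a1, mul_le_mul_of_nonneg_right this a2]
    · have : (s - x) ^ (-ν) ≤ ((t - x) / 2) ^ (-ν) :=
        Real.rpow_le_rpow_of_nonpos hd (by linarith) (by linarith)
      nlinarith [mul_nonneg b1 a2, mul_le_mul_of_nonneg_left this a1]
  refine (setLIntegral_mono' measurableSet_Ioo hpt).trans ?_
  rw [lintegral_add_left (by fun_prop), lintegral_const_mul _ (by fun_prop),
    lintegral_const_mul _ (by fun_prop), pw_left hxt.le hν, pw_right hxt.le hμ]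
  have b1 := Real.rpow_nonneg hd.le (-μ)
  have b2 := Real.rpow_nonneg hd.le (-ν)
  have c1 : 0 ≤ (t - x) ^ (1 - ν) / (1 - ν) := div_nonneg (Real.rpow_nonneg (by linarith) _) (by linarith)
  have c2 : 0 ≤ (t - x) ^ (1 - μ) / (1 - μ) := div_nonneg (Real.rpow_nonneg (by linarith) _) (by linarith)
  rw [← ENNReal.ofReal_mul b1, ← ENNReal.ofReal_mul b2, ← ENNReal.ofReal_add (by positivity) (by positivity)]
  apply ENNReal.ofReal_le_ofReal
  apply le_of_eq
  have hp : 0 < t - x := by linarith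
  have e1 : ((t - x) / 2) ^ (-μ) = 2 ^ μ * (t - x) ^ (-μ) := by
    rw [Real.div_rpow hp.le (by norm_num), Real.rpow_neg (by norm_num : (0:ℝ) ≤ 2)]
    field_simp
  have e2 : ((t - x) / 2) ^ (-ν) = 2 ^ ν * (t - x) ^ (-ν) := by
    rw [Real.div_rpow hp.le (by norm_num), Real.rpow_neg (by norm_num : (0:ℝ) ≤ 2)]
    field_simp
  have f1 : (t - x) ^ (1 - μ - ν) = (t - x) ^ (-μ) * (t - x) ^ (1 - ν) := by
    rw [← Real.rpow_add hp]; ring_nf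
  have f2 : (t - x) ^ (1 - μ - ν) = (t - x) ^ (-ν) * (t - x) ^ (1 - μ) := by
    rw [← Real.rpow_add hp]; ring_nf
  rw [add_mul, e1, e2]
  nth_rewrite 1 [f1]
  rw [f2]
  ring

/-- weighted exponential integral, singularity at 0 -/
lemma exp_left {lam t μ : ℝ} (hl : 0 < lam) (ht : 0 ≤ t) (hμ0 : 0 ≤ μ) (hμ : μ < 1) :
    ∫⁻ x in Ioo 0 t, ENNReal.ofReal (x ^ (-μ) * Real.exp (lam * x)) ≤
      ENNReal.ofReal ((1 / (1 - μ) + 1) * lam ^ (μ - 1) * Real.exp (lam * t)) := by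
  have hli : 0 < lam⁻¹ := inv_pos.2 hl
  have hpt : ∀ x ∈ Ioo 0 t, ENNReal.ofReal (x ^ (-μ) * Real.exp (lam * x)) ≤
      ENNReal.ofReal (Real.exp (lam * t)) * (Ioo 0 lam⁻¹).indicator (fun x => ENNReal.ofReal ((x - 0) ^ (-μ))) x +
      ENNReal.ofReal (lam ^ μ) * ENNReal.ofReal (Real.exp (lam * x)) := by
    intro x hx
    have hx0 := hx.1
    by_cases h : x < lam⁻¹
    · have hmem : x ∈ Ioo 0 lam⁻¹ := ⟨hx0, h⟩
      rw [indicator_of_mem hmem, sub_zero, ← ENNReal.ofReal_mul (Real.exp_pos _).le]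
      refine le_add_right (ENNReal.ofReal_le_ofReal ?_)
      rw [mul_comm]
      have := Real.rpow_nonneg hx0.le (-μ)
      gcongr
      exact hx.2.le
    · refine le_add_left ?_
      rw [← ENNReal.ofReal_mul (Real.rpow_nonneg hl.le _)]
      apply ENNReal.ofReal_le_ofReal
      gcongr
      calc x ^ (-μ) ≤ (lam⁻¹) ^ (-μ) := Real.rpow_le_rpow_of_nonpos hli (not_lt.1 h) (by linarith)
        _ = lam ^ μ := by rw [Real.inv_rpow hl.le, Real.rpow_neg hl.le, inv_inv]
  refine (setLIntegral_mono' measurableSet_Ioo hpt).trans ?_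
  have hm : Measurable ((Ioo 0 lam⁻¹).indicator (fun x : ℝ => ENNReal.ofReal ((x - 0) ^ (-μ)))) :=
    Measurable.indicator (by fun_prop) measurableSet_Ioo
  rw [lintegral_add_left (by fun_prop), lintegral_const_mul _ hm, lintegral_const_mul _ (by fun_prop)]
  have i1 : ∫⁻ x in Ioo 0 t, (Ioo 0 lam⁻¹).indicator (fun x => ENNReal.ofReal ((x - 0) ^ (-μ))) x ≤
      ENNReal.ofReal ((lam⁻¹ - 0) ^ (1 - μ) / (1 - μ)) := by
    rw [← pw_left hli.le hμ, ← lintegral_indicator measurableSet_Ioo (f := fun x : ℝ => ENNReal.ofReal ((x - 0) ^ (-μ)))]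
    exact setLIntegral_le_lintegral _ _
  have i2 := exp_int hl ht
  calc _ ≤ ENNReal.ofReal (Real.exp (lam * t)) * ENNReal.ofReal ((lam⁻¹ - 0) ^ (1 - μ) / (1 - μ)) +
      ENNReal.ofReal (lam ^ μ) * ENNReal.ofReal (Real.exp (lam * t) * lam⁻¹) := by gcongr
    _ = _ := by
      have hq : 0 < 1 - μ := by linarith
      rw [← ENNReal.ofReal_mul (Real.exp_pos _).le, ← ENNReal.ofReal_mul (Real.rpow_nonneg hl.le _),
        ← ENNReal.ofReal_add (by rw [sub_zero]; positivity) (by positivity)]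
      congr 1
      have e1 : (lam⁻¹ - 0) ^ (1 - μ) = lam ^ (μ - 1) := by
        rw [sub_zero, Real.inv_rpow hl.le, ← Real.rpow_neg hl.le]; ring_nf
      have e2 : lam ^ (μ - 1) = lam ^ μ * lam⁻¹ := by
        rw [Real.rpow_sub_one hl.ne']; rfl
      rw [e1, e2]
      ring

lemma exp_right {lam t μ : ℝ} (hl : 0 < lam) (ht : 0 ≤ t) (hμ0 : 0 ≤ μ) (hμ : μ < 1) :
    ∫⁻ x in Ioo 0 t, ENNReal.ofReal ((t - x) ^ (-μ) * Real.exp (lam * x)) ≤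
      ENNReal.ofReal ((1 / (1 - μ) + 1) * lam ^ (μ - 1) * Real.exp (lam * t)) := by
  have hli : 0 < lam⁻¹ := inv_pos.2 hl
  have hpt : ∀ x ∈ Ioo 0 t, ENNReal.ofReal ((t - x) ^ (-μ) * Real.exp (lam * x)) ≤
      ENNReal.ofReal (Real.exp (lam * t)) * (Ioo (t - lam⁻¹) t).indicator (fun x => ENNReal.ofReal ((t - x) ^ (-μ))) x +
      ENNReal.ofReal (lam ^ μ) * ENNReal.ofReal (Real.exp (lam * x)) := by
    intro x hx
    have hx0 : 0 < t - x := by linarith [hx.2]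
    by_cases h : t - x < lam⁻¹
    · have hmem : x ∈ Ioo (t - lam⁻¹) t := ⟨by linarith, hx.2⟩
      rw [indicator_of_mem hmem, ← ENNReal.ofReal_mul (Real.exp_pos _).le]
      refine le_add_right (ENNReal.ofReal_le_ofReal ?_)
      rw [mul_comm]
      have := Real.rpow_nonneg hx0.le (-μ)
      gcongr
      exact hx.2.le
    · refine le_add_left ?_
      rw [← ENNReal.ofReal_mul (Real.rpow_nonneg hl.le _)]
      apply ENNReal.ofReal_le_ofReal
      gcongr
      calc (t - x) ^ (-μ) ≤ (lam⁻¹) ^ (-μ) := Real.rpow_le_rpow_of_nonpos hli (not_lt.1 h) (by linarith)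
        _ = lam ^ μ := by rw [Real.inv_rpow hl.le, Real.rpow_neg hl.le, inv_inv]
  refine (setLIntegral_mono' measurableSet_Ioo hpt).trans ?_
  have hm : Measurable ((Ioo (t - lam⁻¹) t).indicator (fun x : ℝ => ENNReal.ofReal ((t - x) ^ (-μ)))) :=
    Measurable.indicator (by fun_prop) measurableSet_Ioo
  rw [lintegral_add_left (by fun_prop), lintegral_const_mul _ hm, lintegral_const_mul _ (by fun_prop)]
  have i1 : ∫⁻ x in Ioo 0 t, (Ioo (t - lam⁻¹) t).indicator (fun x => ENNReal.ofReal ((t - x) ^ (-μ))) x ≤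
      ENNReal.ofReal ((t - (t - lam⁻¹)) ^ (1 - μ) / (1 - μ)) := by
    rw [← pw_right (by linarith) hμ, ← lintegral_indicator measurableSet_Ioo (f := fun x : ℝ => ENNReal.ofReal ((t - x) ^ (-μ)))]
    exact setLIntegral_le_lintegral _ _
  have i2 := exp_int hl ht
  calc _ ≤ ENNReal.ofReal (Real.exp (lam * t)) * ENNReal.ofReal ((t - (t - lam⁻¹)) ^ (1 - μ) / (1 - μ)) +
      ENNReal.ofReal (lam ^ μ) * ENNReal.ofReal (Real.exp (lam * t) * lam⁻¹) := by gcongr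
    _ = _ := by
      have hq : 0 < 1 - μ := by linarith
      rw [← ENNReal.ofReal_mul (Real.exp_pos _).le, ← ENNReal.ofReal_mul (Real.rpow_nonneg hl.le _),
        ← ENNReal.ofReal_add (by rw [sub_sub_cancel]; positivity) (by positivity)]
      congr 1
      have e1 : (t - (t - lam⁻¹)) ^ (1 - μ) = lam ^ (μ - 1) := by
        rw [sub_sub_cancel, Real.inv_rpow hl.le, ← Real.rpow_neg hl.le]; ring_nf
      have e2 : lam ^ (μ - 1) = lam ^ μ * lam⁻¹ := by
        rw [Real.rpow_sub_one hl.ne']; rfl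
      rw [e1, e2]
      ring

/-- double singularity -/
lemma exp_both {lam t α : ℝ} (hl : 0 < lam) (ht : 0 ≤ t) (hα0 : 0 ≤ α) (hα : α < 1 / 2) :
    ∫⁻ x in Ioo 0 t, ENNReal.ofReal (x ^ (-α) * (t - x) ^ (-α) * Real.exp (lam * x)) ≤
      ENNReal.ofReal (2 * (1 / (1 - 2 * α) + 1) * lam ^ (2 * α - 1) * Real.exp (lam * t)) := by
  have hpt : ∀ x ∈ Ioo 0 t, ENNReal.ofReal (x ^ (-α) * (t - x) ^ (-α) * Real.exp (lam * x)) ≤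
      ENNReal.ofReal (x ^ (-(2 * α)) * Real.exp (lam * x)) +
      ENNReal.ofReal ((t - x) ^ (-(2 * α)) * Real.exp (lam * x)) := by
    intro x hx
    have h1 : 0 < x := hx.1
    have h2 : 0 < t - x := by linarith [hx.2]
    rw [← ENNReal.ofReal_add (by positivity) (by positivity), ← add_mul]
    apply ENNReal.ofReal_le_ofReal
    gcongr
    have e1 : x ^ (-(2 * α)) = x ^ (-α) * x ^ (-α) := by rw [← Real.rpow_add h1]; ring_nf
    have e2 : (t - x) ^ (-(2 * α)) = (t - x) ^ (-α) * (t - x) ^ (-α) := by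
      rw [← Real.rpow_add h2]; ring_nf
    rw [e1, e2]
    nlinarith [sq_nonneg (x ^ (-α) - (t - x) ^ (-α)), Real.rpow_pos_of_pos h1 (-α),
      Real.rpow_pos_of_pos h2 (-α)]
  refine (setLIntegral_mono' measurableSet_Ioo hpt).trans ?_
  rw [lintegral_add_left (by fun_prop)]
  refine (add_le_add (exp_left (μ := 2 * α) hl ht (by linarith) (by linarith))
    (exp_right (μ := 2 * α) hl ht (by linarith) (by linarith))).trans ?_
  have hq : 0 < 1 - 2 * α := by linarith
  rw [← ENNReal.ofReal_add (by positivity) (by positivity)]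
  apply ENNReal.ofReal_le_ofReal
  apply le_of_eq
  ring

/-- Gronwall step -/
lemma gron_step {α T K K0 N lam : ℝ} (hα0 : 0 < α) (hα : α < 1 / 2) (hK : 0 ≤ K) (hK0 : 0 ≤ K0)
    (hN : 0 ≤ N) (hl : 1 ≤ lam)
    (hlK : K * (4 * (1 / (1 - 2 * α) + 1)) * lam ^ (α - 1) ≤ 1 / 2)
    (u v : ℝ → ℝ≥0∞)
    (hu : ∀ t ∈ Icc 0 T, u t ≤ ENNReal.ofReal K0 + ENNReal.ofReal K *
      ∫⁻ r in Ioo 0 t, (ENNReal.ofReal (r ^ (-α)) * u r + v r))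
    (hv : ∀ t ∈ Icc 0 T, v t ≤ ENNReal.ofReal K *
      ∫⁻ r in Ioo 0 t, (ENNReal.ofReal (r ^ (-α)) * u r + v r) * ENNReal.ofReal ((t - r) ^ (-α)))
    (hu1 : ∀ t ∈ Icc 0 T, u t ≤ ENNReal.ofReal (N * Real.exp (lam * t)))
    (hv1 : ∀ t ∈ Icc 0 T, v t ≤ ENNReal.ofReal (N * lam ^ α * Real.exp (lam * t))) :
    (∀ t ∈ Icc 0 T, u t ≤ ENNReal.ofReal ((K0 + N / 2) * Real.exp (lam * t))) ∧
    (∀ t ∈ Icc 0 T, v t ≤ ENNReal.ofReal ((K0 + N / 2) * lam ^ α * Real.exp (lam * t))) := by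
  have hl0 : 0 < lam := by linarith
  have hq : 0 < 1 - 2 * α := by linarith
  have hq1 : 0 < 1 - α := by linarith
  set D := 1 / (1 - 2 * α) + 1 with hD
  have hDpos : 0 < D := by positivity
  have hD1 : 1 / (1 - α) + 1 ≤ D := by
    rw [hD]; gcongr; linarith
  have hD2 : 1 ≤ D := by rw [hD]; have : 0 < 1 / (1 - 2 * α) := by positivity
                         linarith
  have hla := Real.rpow_pos_of_pos hl0 α
  have hlb := Real.rpow_pos_of_pos hl0 (α - 1)
  have hlc : lam ^ α * lam⁻¹ = lam ^ (α - 1) := by rw [Real.rpow_sub_one hl0.ne']; rfl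
  have hld : lam ^ (2 * α - 1) = lam ^ α * lam ^ (α - 1) := by
    rw [← Real.rpow_add hl0]; ring_nf
  constructor
  · intro t ht
    have hE := Real.exp_pos (lam * t)
    have hE1 : 1 ≤ Real.exp (lam * t) := Real.one_le_exp (mul_nonneg hl0.le ht.1)
    refine (hu t ht).trans ?_
    have hI : ∫⁻ r in Ioo 0 t, (ENNReal.ofReal (r ^ (-α)) * u r + v r) ≤
        ENNReal.ofReal N * ENNReal.ofReal (D * lam ^ (α - 1) * Real.exp (lam * t)) +
        ENNReal.ofReal (N * lam ^ α) * ENNReal.ofReal (Real.exp (lam * t) * lam⁻¹) := by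
      calc _ ≤ ∫⁻ r in Ioo 0 t, (ENNReal.ofReal N * ENNReal.ofReal (r ^ (-α) * Real.exp (lam * r)) +
            ENNReal.ofReal (N * lam ^ α) * ENNReal.ofReal (Real.exp (lam * r))) := by
            refine setLIntegral_mono' measurableSet_Ioo fun r hr => ?_
            have hrT : r ∈ Icc 0 T := ⟨hr.1.le, hr.2.le.trans ht.2⟩
            have := Real.rpow_nonneg hr.1.le (-α)
            gcongr ?_ + ?_
            · refine (mul_le_mul_right (hu1 r hrT) _).trans ?_
              rw [← ENNReal.ofReal_mul this, ← ENNReal.ofReal_mul hN]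
              apply ENNReal.ofReal_le_ofReal
              apply le_of_eq; ring
            · refine (hv1 r hrT).trans ?_
              rw [← ENNReal.ofReal_mul (by positivity)]
        _ ≤ _ := by
            rw [lintegral_add_left (by fun_prop), lintegral_const_mul _ (by fun_prop),
              lintegral_const_mul _ (by fun_prop)]
            refine add_le_add (mul_le_mul_right ?_ _) (mul_le_mul_right ?_ _)
            · refine (exp_left hl0 ht.1 hα0.le (by linarith)).trans ?_
              apply ENNReal.ofReal_le_ofReal
              gcongr
            · exact exp_int hl0 ht.1
    refine (add_le_add le_rfl (mul_le_mul_right hI _)).trans ?_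
    rw [← ENNReal.ofReal_mul hN, ← ENNReal.ofReal_mul (by positivity), ← ENNReal.ofReal_add (by positivity) (by positivity),
      ← ENNReal.ofReal_mul hK, ← ENNReal.ofReal_add (by positivity) (by positivity)]
    apply ENNReal.ofReal_le_ofReal
    have e : K * (N * (D * lam ^ (α - 1) * Real.exp (lam * t)) + N * lam ^ α * (Real.exp (lam * t) * lam⁻¹))
        = (K * lam ^ (α - 1) * (D + 1)) * (N * Real.exp (lam * t)) := by
      rw [← hlc]; ring
    rw [e]
    have h1 : K * lam ^ (α - 1) * (D + 1) ≤ 1 / 2 := by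
      refine le_trans ?_ hlK
      have : 0 ≤ K * lam ^ (α - 1) := by positivity
      nlinarith
    have h2 : 0 ≤ N * Real.exp (lam * t) := by positivity
    nlinarith [mul_le_mul_of_nonneg_right h1 h2, mul_le_mul_of_nonneg_left hE1 hK0]
  · intro t ht
    have hE := Real.exp_pos (lam * t)
    refine (hv t ht).trans ?_
    have hI : ∫⁻ r in Ioo 0 t, (ENNReal.ofReal (r ^ (-α)) * u r + v r) * ENNReal.ofReal ((t - r) ^ (-α)) ≤
        ENNReal.ofReal N * ENNReal.ofReal (2 * D * lam ^ (2 * α - 1) * Real.exp (lam * t)) +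
        ENNReal.ofReal (N * lam ^ α) * ENNReal.ofReal (D * lam ^ (α - 1) * Real.exp (lam * t)) := by
      calc _ ≤ ∫⁻ r in Ioo 0 t, (ENNReal.ofReal N * ENNReal.ofReal (r ^ (-α) * (t - r) ^ (-α) * Real.exp (lam * r)) +
            ENNReal.ofReal (N * lam ^ α) * ENNReal.ofReal ((t - r) ^ (-α) * Real.exp (lam * r))) := by
            refine setLIntegral_mono' measurableSet_Ioo fun r hr => ?_
            have hrT : r ∈ Icc 0 T := ⟨hr.1.le, hr.2.le.trans ht.2⟩
            have h1 := Real.rpow_nonneg hr.1.le (-α)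
            have h2 := Real.rpow_nonneg (by linarith [hr.2] : 0 ≤ t - r) (-α)
            rw [add_mul]
            gcongr ?_ + ?_
            · refine (mul_le_mul_left (mul_le_mul_right (hu1 r hrT) _) _).trans ?_
              rw [← ENNReal.ofReal_mul h1, ← ENNReal.ofReal_mul (by positivity), ← ENNReal.ofReal_mul hN]
              apply ENNReal.ofReal_le_ofReal
              apply le_of_eq; ring
            · refine (mul_le_mul_left (hv1 r hrT) _).trans ?_
              rw [← ENNReal.ofReal_mul (by positivity), ← ENNReal.ofReal_mul (by positivity)]
              apply ENNReal.ofReal_le_ofReal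
              apply le_of_eq; ring
        _ ≤ _ := by
            rw [lintegral_add_left (by fun_prop), lintegral_const_mul _ (by fun_prop),
              lintegral_const_mul _ (by fun_prop)]
            refine add_le_add (mul_le_mul_right ?_ _) (mul_le_mul_right ?_ _)
            · exact exp_both hl0 ht.1 hα0.le hα
            · refine (exp_right hl0 ht.1 hα0.le (by linarith)).trans ?_
              apply ENNReal.ofReal_le_ofReal
              gcongr
    refine (mul_le_mul_right hI _).trans ?_
    rw [← ENNReal.ofReal_mul hN, ← ENNReal.ofReal_mul (by positivity), ← ENNReal.ofReal_add (by positivity) (by positivity),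
      ← ENNReal.ofReal_mul hK]
    apply ENNReal.ofReal_le_ofReal
    have e : K * (N * (2 * D * lam ^ (2 * α - 1) * Real.exp (lam * t)) +
        N * lam ^ α * (D * lam ^ (α - 1) * Real.exp (lam * t)))
        = (K * lam ^ (α - 1) * (3 * D)) * (N * lam ^ α * Real.exp (lam * t)) := by
      rw [hld]; ring
    rw [e]
    have h1 : K * lam ^ (α - 1) * (3 * D) ≤ 1 / 2 := by
      refine le_trans ?_ hlK
      have : 0 ≤ K * lam ^ (α - 1) := by positivity
      nlinarith
    have h2 : 0 ≤ N * lam ^ α * Real.exp (lam * t) := by positivity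
    have h3 : 0 ≤ K0 * lam ^ α * Real.exp (lam * t) := by positivity
    nlinarith [mul_le_mul_of_nonneg_right h1 h2]

lemma gron {α T K K0 lam : ℝ} (hα0 : 0 < α) (hα : α < 1 / 2) (hK : 0 ≤ K) (hK0 : 0 ≤ K0)
    (hl : 1 ≤ lam)
    (hlK : K * (4 * (1 / (1 - 2 * α) + 1)) * lam ^ (α - 1) ≤ 1 / 2)
    (u v : ℝ → ℝ≥0∞) (R : ℝ)
    (hu : ∀ t ∈ Icc 0 T, u t ≤ ENNReal.ofReal K0 + ENNReal.ofReal K *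
      ∫⁻ r in Ioo 0 t, (ENNReal.ofReal (r ^ (-α)) * u r + v r))
    (hv : ∀ t ∈ Icc 0 T, v t ≤ ENNReal.ofReal K *
      ∫⁻ r in Ioo 0 t, (ENNReal.ofReal (r ^ (-α)) * u r + v r) * ENNReal.ofReal ((t - r) ^ (-α)))
    (hu1 : ∀ t ∈ Icc 0 T, u t ≤ ENNReal.ofReal R)
    (hv1 : ∀ t ∈ Icc 0 T, v t ≤ ENNReal.ofReal R) :
    ∀ t ∈ Icc 0 T, u t ≤ ENNReal.ofReal (2 * K0 * Real.exp (lam * T)) ∧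
      v t ≤ ENNReal.ofReal (2 * K0 * lam ^ α * Real.exp (lam * T)) := by
  have hl0 : 0 < lam := by linarith
  have hla : 1 ≤ lam ^ α := Real.one_le_rpow hl hα0.le
  have key : ∀ n : ℕ, (∀ t ∈ Icc 0 T, u t ≤ ENNReal.ofReal ((2 * K0 + |R| / 2 ^ n) * Real.exp (lam * t))) ∧
    (∀ t ∈ Icc 0 T, v t ≤ ENNReal.ofReal ((2 * K0 + |R| / 2 ^ n) * lam ^ α * Real.exp (lam * t))) := by
    intro n
    induction n with
    | zero =>
      have hE : ∀ t ∈ Icc 0 T, 1 ≤ Real.exp (lam * t) := fun t ht =>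
        Real.one_le_exp (mul_nonneg hl0.le ht.1)
      have hb : R ≤ 2 * K0 + |R| / 2 ^ 0 := by simp; linarith [le_abs_self R]
      have hb0 : 0 ≤ 2 * K0 + |R| / 2 ^ 0 := by positivity
      refine ⟨fun t ht => (hu1 t ht).trans (ENNReal.ofReal_le_ofReal ?_),
        fun t ht => (hv1 t ht).trans (ENNReal.ofReal_le_ofReal ?_)⟩
      · nlinarith [hE t ht]
      · have := hE t ht
        calc R ≤ (2 * K0 + |R| / 2 ^ 0) * 1 * 1 := by linarith
          _ ≤ _ := by gcongr
    | succ n ih =>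
      have := gron_step (T := T) hα0 hα hK hK0 (N := 2 * K0 + |R| / 2 ^ n) (by positivity) hl hlK u v hu hv ih.1 ih.2
      have e : K0 + (2 * K0 + |R| / 2 ^ n) / 2 = 2 * K0 + |R| / 2 ^ (n + 1) := by
        rw [pow_succ]; field_simp; ring
      rwa [e] at this
  have hlim : Filter.Tendsto (fun n : ℕ => 2 * K0 + |R| / 2 ^ n) Filter.atTop (nhds (2 * K0)) := by
    have := (tendsto_pow_atTop_nhds_zero_of_lt_one (by norm_num : (0:ℝ) ≤ 1/2) (by norm_num)).const_mul |R|
    have := this.const_add (2 * K0)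
    simpa [div_eq_mul_inv] using this
  intro t ht
  have hEt : Real.exp (lam * t) ≤ Real.exp (lam * T) := by
    gcongr; exact ht.2
  constructor
  · have h1 := ENNReal.tendsto_ofReal (hlim.mul_const (Real.exp (lam * t)))
    refine (ge_of_tendsto' h1 fun n => (key n).1 t ht).trans (ENNReal.ofReal_le_ofReal ?_)
    gcongr
  · have h1 := ENNReal.tendsto_ofReal ((hlim.mul_const (lam ^ α)).mul_const (Real.exp (lam * t)))
    refine (ge_of_tendsto' h1 fun n => (key n).2 t ht).trans (ENNReal.ofReal_le_ofReal ?_)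
    gcongr

/-! ### Fractional derivatives: measurability and bounds -/

lemma measurableSet_tri (a : ℝ) : MeasurableSet {p : ℝ × ℝ | a < p.2 ∧ p.2 < p.1} :=
  (measurableSet_lt measurable_const measurable_snd).inter (measurableSet_lt measurable_snd measurable_fst)

lemma measurableSet_tri' (b : ℝ) : MeasurableSet {p : ℝ × ℝ | p.1 < p.2 ∧ p.2 < b} :=
  (measurableSet_lt measurable_fst measurable_snd).inter (measurableSet_lt measurable_snd measurable_const)

lemma meas_fracP (α a : ℝ) {f : ℝ → ℝ} (hf : Measurable f) : Measurable (fracDerivP α a f) := by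
  have h : Measurable fun x => ∫ u in Ioo a x, (f x - f u) / (x - u) ^ (1 + α) := by
    have e : (fun x => ∫ u in Ioo a x, (f x - f u) / (x - u) ^ (1 + α)) =
        fun x => ∫ u, Function.curry ({p : ℝ × ℝ | a < p.2 ∧ p.2 < p.1}.indicator
          (fun p => (f p.1 - f p.2) / (p.1 - p.2) ^ (1 + α))) x u := by
      funext x
      rw [← integral_indicator measurableSet_Ioo]
      rfl
    rw [e]
    apply StronglyMeasurable.measurable
    apply StronglyMeasurable.integral_prod_right
    apply Measurable.stronglyMeasurable
    exact Measurable.indicator (by fun_prop) (measurableSet_tri a)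
  unfold fracDerivP
  fun_prop

lemma meas_fracM (α b : ℝ) {g : ℝ → ℝ} (hg : Measurable g) : Measurable (fracDerivM α b g) := by
  have h : Measurable fun x => ∫ u in Ioo x b, (g x - g u) / (u - x) ^ (2 - α) := by
    have e : (fun x => ∫ u in Ioo x b, (g x - g u) / (u - x) ^ (2 - α)) =
        fun x => ∫ u, Function.curry ({p : ℝ × ℝ | p.1 < p.2 ∧ p.2 < b}.indicator
          (fun p => (g p.1 - g p.2) / (p.2 - p.1) ^ (2 - α))) x u := by
      funext x
      rw [← integral_indicator measurableSet_Ioo]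
      rfl
    rw [e]
    apply StronglyMeasurable.measurable
    apply StronglyMeasurable.integral_prod_right
    apply Measurable.stronglyMeasurable
    exact Measurable.indicator (by fun_prop) (measurableSet_tri' b)
  unfold fracDerivM
  fun_prop

lemma meas_pathNorm (α : ℝ) {f : ℝ → ℝ} (hf : Measurable f) : Measurable (pathNorm α f) := by
  have e : pathNorm α f =
      fun x => ∫⁻ u, Function.curry ({p : ℝ × ℝ | 0 < p.2 ∧ p.2 < p.1}.indicator
        (fun p => ENNReal.ofReal (|f p.1 - f p.2| * (p.1 - p.2) ^ (-1 - α)))) x u := by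
    funext x
    unfold pathNorm
    rw [← lintegral_indicator measurableSet_Ioo]
    rfl
  rw [e]
  apply Measurable.lintegral_prod_right
  exact Measurable.indicator (by fun_prop) (measurableSet_tri 0)

/-- The majorant `Φ` of the left fractional derivative. -/
noncomputable def PhiM (α : ℝ) (f : ℝ → ℝ) (x : ℝ) : ℝ≥0∞ :=
  ENNReal.ofReal (|f x| * x ^ (-α)) + pathNorm α f x

lemma meas_PhiM (α : ℝ) {f : ℝ → ℝ} (hf : Measurable f) : Measurable (PhiM α f) := by
  unfold PhiM
  have := meas_pathNorm α hf
  fun_prop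

lemma fracP_bound {α : ℝ} (hα0 : 0 < α) (hα : α < 1) (f : ℝ → ℝ) {x : ℝ} (hx : 0 < x) :
    ‖fracDerivP α 0 f x‖ₑ ≤ ENNReal.ofReal (1 / Real.Gamma (1 - α)) * PhiM α f x := by
  have hG : 0 < Real.Gamma (1 - α) := Real.Gamma_pos_of_pos (by linarith)
  unfold fracDerivP PhiM
  rw [enorm_mul, Real.enorm_of_nonneg (by positivity)]
  refine mul_le_mul_right ((enorm_add_le _ _).trans (add_le_add ?_ ?_)) _
  · rw [← ofReal_norm]
    apply ENNReal.ofReal_le_ofReal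
    rw [norm_div, Real.norm_eq_abs, Real.norm_of_nonneg (Real.rpow_nonneg (by linarith) _), sub_zero,
      Real.rpow_neg hx.le]
    rfl
  · rw [enorm_mul]
    have h1 : ‖α‖ₑ ≤ 1 := by
      rw [Real.enorm_of_nonneg hα0.le, ← ENNReal.ofReal_one]
      exact ENNReal.ofReal_le_ofReal hα.le
    calc _ ≤ 1 * _ := mul_le_mul_left h1 _
      _ = _ := one_mul _
      _ ≤ _ := enorm_integral_le_lintegral_enorm _
      _ ≤ pathNorm α f x := by
        unfold pathNorm
        refine setLIntegral_mono' measurableSet_Ioo fun u hu => ?_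
        have hxu : 0 ≤ x - u := by linarith [hu.2]
        rw [← ofReal_norm]
        apply ENNReal.ofReal_le_ofReal
        rw [norm_div, Real.norm_eq_abs, Real.norm_of_nonneg (Real.rpow_nonneg hxu _),
          show -1 - α = -(1 + α) by ring, Real.rpow_neg hxu]
        rfl

lemma holder_int {α θ G x b : ℝ} (hθ : 1 - α < θ) (hG : 0 ≤ G) {g : ℝ → ℝ}
    (hg : ∀ s t, |g s - g t| ≤ G * |s - t| ^ θ) (hxb : x ≤ b) :
    ∫⁻ u in Ioo x b, ‖(g x - g u) / (u - x) ^ (2 - α)‖ₑ ≤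
      ENNReal.ofReal (G * ((b - x) ^ (θ - (1 - α)) / (θ - (1 - α)))) := by
  calc _ ≤ ∫⁻ u in Ioo x b, ENNReal.ofReal G * ENNReal.ofReal ((u - x) ^ (-(2 - α - θ))) := by
        refine setLIntegral_mono' measurableSet_Ioo fun u hu => ?_
        have hxu : 0 < u - x := by linarith [hu.1]
        rw [← ofReal_norm, ← ENNReal.ofReal_mul hG]
        apply ENNReal.ofReal_le_ofReal
        rw [norm_div, Real.norm_eq_abs, Real.norm_of_nonneg (Real.rpow_nonneg hxu.le _),
          show -(2 - α - θ) = θ - (2 - α) by ring, Real.rpow_sub hxu θ (2 - α), ← mul_div_assoc]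
        gcongr
        have := hg x u
        rwa [abs_sub_comm x u, abs_of_pos hxu] at this
    _ = _ := by
        rw [lintegral_const_mul _ (by fun_prop), pw_left hxb (by linarith), ← ENNReal.ofReal_mul hG]
        congr 3 <;> ring_nf

/-- bound of the right fractional derivative -/
lemma fracM_bound {α θ G x b T : ℝ} (hα0 : 0 < α) (hα : α < 1) (hθ : 1 - α < θ) (hG : 0 ≤ G) {g : ℝ → ℝ}
    (hg : ∀ s t, |g s - g t| ≤ G * |s - t| ^ θ) (hxb : x < b) (hT : b - x ≤ T) :
    ‖fracDerivM α b g x‖ₑ ≤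
      ENNReal.ofReal (1 / Real.Gamma α * ((1 + 1 / (θ - (1 - α))) * T ^ (θ - (1 - α))) * G) := by
  have hGa : 0 < Real.Gamma α := Real.Gamma_pos_of_pos hα0
  have hbx : 0 < b - x := by linarith
  have hq : 0 < θ - (1 - α) := by linarith
  have hT0 : 0 < T := by linarith
  have hpow : (b - x) ^ (θ - (1 - α)) ≤ T ^ (θ - (1 - α)) := by gcongr
  unfold fracDerivM
  rw [enorm_mul, Real.enorm_of_nonneg (by positivity), mul_assoc (1 / Real.Gamma α),
    ENNReal.ofReal_mul (by positivity)]
  refine mul_le_mul_right ((enorm_add_le _ _).trans ?_) _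
  have h1 : ‖(g x - g b) / (b - x) ^ (1 - α)‖ₑ ≤ ENNReal.ofReal (T ^ (θ - (1 - α)) * G) := by
    rw [← ofReal_norm]
    apply ENNReal.ofReal_le_ofReal
    rw [norm_div, Real.norm_eq_abs, Real.norm_of_nonneg (Real.rpow_nonneg hbx.le _)]
    calc _ ≤ G * (b - x) ^ θ / (b - x) ^ (1 - α) := by
          gcongr
          have := hg x b
          rwa [abs_sub_comm x b, abs_of_pos hbx] at this
      _ = (b - x) ^ (θ - (1 - α)) * G := by rw [Real.rpow_sub hbx θ (1 - α)]; ring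
      _ ≤ _ := by gcongr
  have h2 : ‖(1 - α) * ∫ u in Ioo x b, (g x - g u) / (u - x) ^ (2 - α)‖ₑ ≤
      ENNReal.ofReal (1 / (θ - (1 - α)) * T ^ (θ - (1 - α)) * G) := by
    rw [enorm_mul]
    have h1 : ‖1 - α‖ₑ ≤ 1 := by
      rw [Real.enorm_of_nonneg (by linarith), ← ENNReal.ofReal_one]
      exact ENNReal.ofReal_le_ofReal (by linarith)
    calc _ ≤ 1 * _ := mul_le_mul_left h1 _
      _ = _ := one_mul _
      _ ≤ _ := enorm_integral_le_lintegral_enorm _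
      _ ≤ _ := holder_int hθ hG hg hxb.le
      _ ≤ _ := by
        apply ENNReal.ofReal_le_ofReal
        calc _ ≤ G * (T ^ (θ - (1 - α)) / (θ - (1 - α))) := by gcongr
          _ = _ := by ring
  refine (add_le_add h1 h2).trans ?_
  rw [← ENNReal.ofReal_add (by positivity) (by positivity)]
  apply ENNReal.ofReal_le_ofReal
  apply le_of_eq; ring

lemma holder_meas {g : ℝ → ℝ} {G θ : ℝ} (hθ : 0 < θ)
    (hg : ∀ s t, |g s - g t| ≤ G * |s - t| ^ θ) : Continuous g := by
  rw [continuous_iff_continuousAt]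
  intro t
  rw [ContinuousAt, tendsto_iff_dist_tendsto_zero]
  have h : Filter.Tendsto (fun s => G * |s - t| ^ θ) (nhds t) (nhds 0) := by
    have : Continuous fun s => G * |s - t| ^ θ := by
      apply Continuous.mul continuous_const
      exact Continuous.rpow_const (by fun_prop) (fun _ => Or.inr hθ.le)
    have := this.tendsto t
    simpa [Real.zero_rpow hθ.ne'] using this
  exact squeeze_zero (fun _ => dist_nonneg) (fun s => hg s t) h

/-- the increment in the endpoint of the right fractional derivative -/
lemma fracM_diff {α θ G x s t : ℝ} (hα0 : 0 < α) (hα : α < 1) (hθ : 1 - α < θ) (hG : 0 ≤ G) {g : ℝ → ℝ}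
    (hg : ∀ s t, |g s - g t| ≤ G * |s - t| ^ θ) (hxs : x < s) (hst : s < t) :
    fracDerivM α t g x - fracDerivM α s g x = (1 / Real.Gamma α) *
      ((g s - g t) / (t - x) ^ (1 - α) + (1 - α) * ∫ u in Ioo s t, (g s - g u) / (u - x) ^ (2 - α)) := by
  have hcg : Continuous g := holder_meas (by linarith) hg
  have hmg := hcg.measurable
  have hsx : 0 < s - x := by linarith
  have htx : 0 < t - x := by linarith
  have hInt : IntegrableOn (fun u => (g x - g u) / (u - x) ^ (2 - α)) (Ioo x t) := by
    refine ⟨Measurable.aestronglyMeasurable (by fun_prop), ?_⟩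
    exact (holder_int hθ hG hg (by linarith)).trans_lt ENNReal.ofReal_lt_top
  have hInt1 : IntegrableOn (fun u => (g x - g u) / (u - x) ^ (2 - α)) (Ioc x s) :=
    hInt.mono_set fun u hu => ⟨hu.1, hu.2.trans_lt hst⟩
  have hInt2 : IntegrableOn (fun u => (g x - g u) / (u - x) ^ (2 - α)) (Ioo s t) :=
    hInt.mono_set fun u hu => ⟨hxs.trans hu.1, hu.2⟩
  have hsplit : ∫ u in Ioo x t, (g x - g u) / (u - x) ^ (2 - α) =
      (∫ u in Ioo x s, (g x - g u) / (u - x) ^ (2 - α)) + ∫ u in Ioo s t, (g x - g u) / (u - x) ^ (2 - α) := by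
    rw [← Ioc_union_Ioo_eq_Ioo hxs.le hst, setIntegral_union _ measurableSet_Ioo hInt1 hInt2,
      integral_Ioc_eq_integral_Ioo]
    rw [Set.disjoint_left]
    intro u hu hu2
    exact absurd hu.2 (not_le.2 hu2.1)
  have hpc : ContinuousOn (fun u : ℝ => (u - x) ^ (-(2 - α))) (Icc s t) := by
    intro u hu
    apply ContinuousAt.continuousWithinAt
    apply ContinuousAt.rpow_const (by fun_prop)
    left
    have := hu.1
    intro h
    linarith
  have hpi : IntegrableOn (fun u : ℝ => (g x - g s) * (u - x) ^ (-(2 - α))) (Ioo s t) :=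
    ((hpc.integrableOn_Icc).mono_set Ioo_subset_Icc_self).const_mul _
  have hpi2 : IntegrableOn (fun u : ℝ => (g s - g u) / (u - x) ^ (2 - α)) (Ioo s t) := by
    have : ContinuousOn (fun u : ℝ => (g s - g u) / (u - x) ^ (2 - α)) (Icc s t) := by
      have : ContinuousOn (fun u : ℝ => (g s - g u) * (u - x) ^ (-(2 - α))) (Icc s t) :=
        ContinuousOn.mul (by fun_prop) hpc
      refine this.congr fun u hu => ?_
      have hu0 : 0 ≤ u - x := by linarith [hu.1]
      simp only [Real.rpow_neg hu0]; rfl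
    exact this.integrableOn_Icc.mono_set Ioo_subset_Icc_self
  have hsplit2 : ∫ u in Ioo s t, (g x - g u) / (u - x) ^ (2 - α) =
      (g x - g s) * (∫ u in Ioo s t, (u - x) ^ (-(2 - α))) + ∫ u in Ioo s t, (g s - g u) / (u - x) ^ (2 - α) := by
    rw [← integral_const_mul, ← integral_add hpi hpi2]
    refine setIntegral_congr_fun measurableSet_Ioo fun u hu => ?_
    have hu0 : 0 ≤ u - x := by linarith [hu.1]
    rw [Real.rpow_neg hu0]
    ring
  have hpow : ∫ u in Ioo s t, (u - x) ^ (-(2 - α)) =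
      ((s - x) ^ (-(1 - α)) - (t - x) ^ (-(1 - α))) / (1 - α) := by
    rw [← integral_Ioc_eq_integral_Ioo, ← intervalIntegral.integral_of_le hst.le,
      intervalIntegral.integral_comp_sub_right (fun x : ℝ => x ^ (-(2 - α))) x, integral_rpow]
    · have e : -(2 - α) + 1 = -(1 - α) := by ring
      rw [e, div_neg, ← neg_div, neg_sub]
    · right
      refine ⟨by linarith, ?_⟩
      rw [uIcc_of_le (by linarith)]
      intro h
      linarith [h.1]
  have hα1 : 1 - α ≠ 0 := by linarith
  unfold fracDerivM
  rw [hsplit, hsplit2, hpow, Real.rpow_neg hsx.le, Real.rpow_neg htx.le]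
  field_simp
  ring

lemma fracM_diff_bound {α θ G x s t : ℝ} (hα0 : 0 < α) (hα : α < 1) (hθ : 1 - α < θ) (hG : 0 ≤ G) {g : ℝ → ℝ}
    (hg : ∀ s t, |g s - g t| ≤ G * |s - t| ^ θ) (hxs : x < s) (hst : s < t) :
    ‖fracDerivM α t g x - fracDerivM α s g x‖ₑ ≤
      ENNReal.ofReal (1 / Real.Gamma α * (1 + 1 / θ) * G) *
        ENNReal.ofReal ((t - s) ^ θ * (s - x) ^ (-(1 - α))) := by
  have hGa : 0 < Real.Gamma α := Real.Gamma_pos_of_pos hα0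
  have hsx : 0 < s - x := by linarith
  have htx : 0 < t - x := by linarith
  have hts : 0 < t - s := by linarith
  have hθ0 : 0 < θ := by linarith
  rw [fracM_diff hα0 hα hθ hG hg hxs hst, enorm_mul, Real.enorm_of_nonneg (by positivity)]
  have h1 : ‖(g s - g t) / (t - x) ^ (1 - α)‖ₑ ≤ ENNReal.ofReal (G * ((t - s) ^ θ * (s - x) ^ (-(1 - α)))) := by
    rw [← ofReal_norm]
    apply ENNReal.ofReal_le_ofReal
    rw [norm_div, Real.norm_eq_abs, Real.norm_of_nonneg (Real.rpow_nonneg htx.le _), div_eq_mul_inv,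
      ← Real.rpow_neg htx.le, ← mul_assoc]
    have h0 := hg s t
    rw [abs_sub_comm s t, abs_of_pos hts] at h0
    have h2 : (t - x) ^ (-(1 - α)) ≤ (s - x) ^ (-(1 - α)) :=
      Real.rpow_le_rpow_of_nonpos hsx (by linarith) (by linarith)
    gcongr
  have h2 : ‖(1 - α) * ∫ u in Ioo s t, (g s - g u) / (u - x) ^ (2 - α)‖ₑ ≤
      ENNReal.ofReal (1 / θ * (G * ((t - s) ^ θ * (s - x) ^ (-(1 - α))))) := by
    rw [enorm_mul]
    have h1 : ‖1 - α‖ₑ ≤ 1 := by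
      rw [Real.enorm_of_nonneg (by linarith), ← ENNReal.ofReal_one]
      exact ENNReal.ofReal_le_ofReal (by linarith)
    calc _ ≤ 1 * _ := mul_le_mul_left h1 _
      _ = _ := one_mul _
      _ ≤ _ := enorm_integral_le_lintegral_enorm _
      _ ≤ ∫⁻ u in Ioo s t, ENNReal.ofReal (G * (s - x) ^ (-(1 - α))) * ENNReal.ofReal ((u - s) ^ (-(1 - θ))) := by
        refine setLIntegral_mono' measurableSet_Ioo fun u hu => ?_
        have hus : 0 < u - s := by linarith [hu.1]
        have hux : 0 < u - x := by linarith
        rw [← ofReal_norm, ← ENNReal.ofReal_mul (by positivity)]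
        apply ENNReal.ofReal_le_ofReal
        rw [norm_div, Real.norm_eq_abs, Real.norm_of_nonneg (Real.rpow_nonneg hux.le _), div_eq_mul_inv,
          ← Real.rpow_neg hux.le]
        have h0 := hg s u
        rw [abs_sub_comm s u, abs_of_pos hus] at h0
        have e1 : (u - x) ^ (-(2 - α)) = (u - x) ^ (-(1 - α)) * (u - x) ^ (-1 : ℝ) := by
          rw [← Real.rpow_add hux]; ring_nf
        have e2 : (u - s) ^ (-(1 - θ)) = (u - s) ^ θ * (u - s) ^ (-1 : ℝ) := by
          rw [← Real.rpow_add hus]; ring_nf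
        have i1 : (u - x) ^ (-(1 - α)) ≤ (s - x) ^ (-(1 - α)) :=
          Real.rpow_le_rpow_of_nonpos hsx (by linarith) (by linarith)
        have i2 : (u - x) ^ (-1 : ℝ) ≤ (u - s) ^ (-1 : ℝ) :=
          Real.rpow_le_rpow_of_nonpos hus (by linarith) (by linarith)
        rw [e1, e2]
        calc _ ≤ (G * (u - s) ^ θ) * ((s - x) ^ (-(1 - α)) * (u - s) ^ (-1 : ℝ)) := by gcongr
          _ = _ := by ring
      _ ≤ _ := by
        rw [lintegral_const_mul _ (by fun_prop), pw_left hst.le (by linarith), ← ENNReal.ofReal_mul (by positivity)]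
        apply ENNReal.ofReal_le_ofReal
        apply le_of_eq
        rw [show 1 - (1 - θ) = θ by ring]
        ring
  refine (mul_le_mul_right ((enorm_add_le _ _).trans (add_le_add h1 h2)) _).trans ?_
  rw [← ENNReal.ofReal_add (by positivity) (by positivity), ← ENNReal.ofReal_mul (by positivity),
    ← ENNReal.ofReal_mul (by positivity)]
  apply ENNReal.ofReal_le_ofReal
  apply le_of_eq; ring

/-! ### Tonelli on triangles -/

lemma tri_swap {t : ℝ} {F : ℝ → ℝ → ℝ≥0∞} (hF : Measurable (Function.uncurry F)) :
    ∫⁻ s in Ioo 0 t, ∫⁻ x in Ioo s t, F s x = ∫⁻ x in Ioo 0 t, ∫⁻ s in Ioo 0 x, F s x := by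
  have hm : MeasurableSet {p : ℝ × ℝ | (0 < p.1 ∧ p.1 < p.2) ∧ p.2 < t} :=
    ((measurableSet_lt measurable_const measurable_fst).inter
      (measurableSet_lt measurable_fst measurable_snd)).inter
      (measurableSet_lt measurable_snd measurable_const)
  set Q : ℝ → ℝ → ℝ≥0∞ := fun s x =>
    {p : ℝ × ℝ | (0 < p.1 ∧ p.1 < p.2) ∧ p.2 < t}.indicator (Function.uncurry F) (s, x) with hQ
  have h1 : ∫⁻ s in Ioo 0 t, ∫⁻ x in Ioo s t, F s x = ∫⁻ s, ∫⁻ x, Q s x := by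
    rw [← lintegral_indicator measurableSet_Ioo]
    congr 1
    funext s
    by_cases hs : s ∈ Ioo 0 t
    · rw [indicator_of_mem hs, ← lintegral_indicator measurableSet_Ioo]
      congr 1
      funext x
      simp only [hQ, indicator_apply, mem_Ioo, mem_setOf_eq, Function.uncurry]
      congr 1
      simp [hs.1]
    · rw [indicator_of_notMem hs]
      symm
      rw [lintegral_eq_zero_iff']
      · refine Filter.Eventually.of_forall fun x => ?_
        simp only [hQ, indicator_apply, mem_setOf_eq]
        rw [if_neg]; · rfl
        rintro ⟨⟨a, b⟩, c⟩
        exact hs ⟨a, b.trans c⟩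
      · exact ((hF.indicator hm).comp measurable_prodMk_left).aemeasurable
  have h2 : ∫⁻ x in Ioo 0 t, ∫⁻ s in Ioo 0 x, F s x = ∫⁻ x, ∫⁻ s, Q s x := by
    rw [← lintegral_indicator measurableSet_Ioo]
    congr 1
    funext x
    by_cases hx : x ∈ Ioo 0 t
    · rw [indicator_of_mem hx, ← lintegral_indicator measurableSet_Ioo]
      congr 1
      funext s
      simp only [hQ, indicator_apply, mem_Ioo, mem_setOf_eq, Function.uncurry]
      congr 1
      simp [hx.2]
    · rw [indicator_of_notMem hx]
      symm
      rw [lintegral_eq_zero_iff']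
      · refine Filter.Eventually.of_forall fun s => ?_
        simp only [hQ, indicator_apply, mem_setOf_eq]
        rw [if_neg]; · rfl
        rintro ⟨⟨a, b⟩, c⟩
        exact hx ⟨a.trans b, c⟩
      · exact ((hF.indicator hm).comp measurable_prodMk_right).aemeasurable
  rw [h1, h2]
  exact lintegral_lintegral_swap (hF.indicator hm).aemeasurable

lemma ton1 {α t : ℝ} (hα : 0 < α) {Φ : ℝ → ℝ≥0∞} (hΦ : Measurable Φ) :
    ∫⁻ s in Ioo 0 t, (∫⁻ x in Ioo s t, Φ x) * ENNReal.ofReal ((t - s) ^ (-1 - α)) ≤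
      ENNReal.ofReal (1 / α) * ∫⁻ x in Ioo 0 t, Φ x * ENNReal.ofReal ((t - x) ^ (-α)) := by
  calc _ = ∫⁻ s in Ioo 0 t, ∫⁻ x in Ioo s t, Φ x * ENNReal.ofReal ((t - s) ^ (-1 - α)) := by
        congr 1; funext s
        rw [lintegral_mul_const _ hΦ]
    _ = ∫⁻ x in Ioo 0 t, ∫⁻ s in Ioo 0 x, Φ x * ENNReal.ofReal ((t - s) ^ (-1 - α)) :=
        tri_swap (by unfold Function.uncurry; fun_prop)
    _ ≤ ∫⁻ x in Ioo 0 t, ENNReal.ofReal (1 / α) * (Φ x * ENNReal.ofReal ((t - x) ^ (-α))) := by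
        refine setLIntegral_mono' measurableSet_Ioo fun x hx => ?_
        rw [lintegral_const_mul _ (by fun_prop)]
        refine (mul_le_mul_right (pw_tail hα hx.1.le hx.2) _).trans (le_of_eq ?_)
        rw [div_eq_mul_one_div, ENNReal.ofReal_mul (Real.rpow_nonneg (by linarith [hx.2]) _)]
        ring
    _ = _ := by rw [lintegral_const_mul _ (by fun_prop)]

lemma ton2 {α θ t T : ℝ} (hα0 : 0 < α) (hα : α < 1 / 2) (hθ : 1 - α < θ) (hθ1 : θ ≤ 1) (htT : t ≤ T)
    {Φ : ℝ → ℝ≥0∞} (hΦ : Measurable Φ) :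
    ∫⁻ s in Ioo 0 t, (∫⁻ x in Ioo 0 s, Φ x * ENNReal.ofReal ((t - s) ^ θ * (s - x) ^ (-(1 - α)))) *
        ENNReal.ofReal ((t - s) ^ (-1 - α)) ≤
      ENNReal.ofReal ((2 ^ (1 + α - θ) / (1 - (1 - α)) + 2 ^ (1 - α) / (1 - (1 + α - θ))) * T ^ (θ - (1 - α))) *
        ∫⁻ x in Ioo 0 t, Φ x * ENNReal.ofReal ((t - x) ^ (-α)) := by
  set Cb : ℝ := (2 ^ (1 + α - θ) / (1 - (1 - α)) + 2 ^ (1 - α) / (1 - (1 + α - θ))) with hCb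
  have hCb0 : 0 ≤ Cb := by
    have h1 : 0 < 1 - (1 - α) := by linarith
    have h2 : 0 < 1 - (1 + α - θ) := by linarith
    positivity
  calc _ = ∫⁻ s in Ioo 0 t, ∫⁻ x in Ioo 0 s, Φ x * ENNReal.ofReal ((t - s) ^ θ * (s - x) ^ (-(1 - α))) *
        ENNReal.ofReal ((t - s) ^ (-1 - α)) := by
        congr 1; funext s
        rw [lintegral_mul_const _ (by fun_prop)]
    _ = ∫⁻ x in Ioo 0 t, ∫⁻ s in Ioo x t, Φ x * ENNReal.ofReal ((t - s) ^ θ * (s - x) ^ (-(1 - α))) *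
        ENNReal.ofReal ((t - s) ^ (-1 - α)) := by
        refine (tri_swap (F := fun x s => Φ x * ENNReal.ofReal ((t - s) ^ θ * (s - x) ^ (-(1 - α))) *
          ENNReal.ofReal ((t - s) ^ (-1 - α))) ?_).symm
        unfold Function.uncurry; fun_prop
    _ ≤ ∫⁻ x in Ioo 0 t, ENNReal.ofReal (Cb * T ^ (θ - (1 - α))) * (Φ x * ENNReal.ofReal ((t - x) ^ (-α))) := by
        refine setLIntegral_mono' measurableSet_Ioo fun x hx => ?_
        have htx : 0 < t - x := by linarith [hx.2]
        simp_rw [mul_assoc]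
        rw [lintegral_const_mul _ (by fun_prop), mul_left_comm]
        refine mul_le_mul_right ?_ _
        calc _ = ∫⁻ s in Ioo x t, ENNReal.ofReal ((t - s) ^ (-(1 + α - θ)) * (s - x) ^ (-(1 - α))) := by
              refine setLIntegral_congr_fun measurableSet_Ioo fun s hs => ?_
              have hts : 0 < t - s := by linarith [hs.2]
              have hsx : 0 < s - x := by linarith [hs.1]
              rw [← ENNReal.ofReal_mul (by positivity)]
              congr 1
              have : (t - s) ^ (-(1 + α - θ)) = (t - s) ^ θ * (t - s) ^ (-1 - α) := by
                rw [← Real.rpow_add hts]; ring_nf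
              rw [this]; ring
          _ ≤ _ := pw_beta hx.2 (by linarith) (by linarith) (by linarith) (by linarith)
          _ ≤ _ := by
              rw [← ENNReal.ofReal_mul (by have : 0 ≤ T := by linarith [hx.1]
                                           positivity)]
              apply ENNReal.ofReal_le_ofReal
              rw [mul_assoc]
              refine mul_le_mul_of_nonneg_left ?_ hCb0
              have e : (t - x) ^ (1 - (1 + α - θ) - (1 - α)) = (t - x) ^ (θ - (1 - α)) * (t - x) ^ (-α) := by
                rw [← Real.rpow_add htx]; ring_nf
              rw [e]
              gcongr
              linarith [hx.1]
    _ = _ := by rw [lintegral_const_mul _ (by fun_prop)]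

/-! ### Estimates of the generalized Lebesgue-Stieltjes integral -/

lemma gls_est {α θ T : ℝ} (hα0 : 0 < α) (hα : α < 1 / 2) (hθ : 1 - α < θ) (hθ1 : θ ≤ 1) (hT : 0 < T) :
    ∃ C : ℝ, 0 ≤ C ∧ ∀ (f g : ℝ → ℝ) (G : ℝ), 0 ≤ G → Measurable f →
      (∀ s t, |g s - g t| ≤ G * |s - t| ^ θ) →
      (∫⁻ x in Ioo 0 T, PhiM α f x) < ⊤ → ∀ t ∈ Icc 0 T,
      (ENNReal.ofReal |glsIntegral α 0 t f g| ≤ ENNReal.ofReal (C * G) * ∫⁻ x in Ioo 0 t, PhiM α f x) ∧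
      (pathNorm α (fun s => glsIntegral α 0 s f g) t ≤
        ENNReal.ofReal (C * G) * ∫⁻ x in Ioo 0 t, PhiM α f x * ENNReal.ofReal ((t - x) ^ (-α))) := by
  have hα1 : α < 1 := by linarith
  have hGa : 0 < Real.Gamma α := Real.Gamma_pos_of_pos hα0
  have hGb : 0 < Real.Gamma (1 - α) := Real.Gamma_pos_of_pos (by linarith)
  have hq : 0 < θ - (1 - α) := by linarith
  have hθ0 : 0 < θ := by linarith
  obtain ⟨c1, hc1⟩ : ∃ c1, c1 = 1 / Real.Gamma (1 - α) := ⟨_, rfl⟩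
  obtain ⟨c2, hc2⟩ : ∃ c2, c2 = 1 / Real.Gamma α * ((1 + 1 / (θ - (1 - α))) * T ^ (θ - (1 - α))) := ⟨_, rfl⟩
  obtain ⟨c3, hc3⟩ : ∃ c3, c3 = 1 / Real.Gamma α * (1 + 1 / θ) := ⟨_, rfl⟩
  obtain ⟨c4, hc4⟩ : ∃ c4, c4 = (2 ^ (1 + α - θ) / (1 - (1 - α)) + 2 ^ (1 - α) / (1 - (1 + α - θ))) * T ^ (θ - (1 - α)) := ⟨_, rfl⟩
  have hc10 : 0 ≤ c1 := by rw [hc1]; positivity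
  have hc20 : 0 ≤ c2 := by rw [hc2]; positivity
  have hc30 : 0 ≤ c3 := by rw [hc3]; positivity
  have hc40 : 0 ≤ c4 := by
    have h1 : 0 < 1 - (1 - α) := by linarith
    have h2 : 0 < 1 - (1 + α - θ) := by linarith
    rw [hc4]; positivity
  refine ⟨c1 * c2 + c1 * (c2 * (1 / α) + c3 * c4), by positivity, ?_⟩
  intro f g G hG hf hg hfin t ht
  have hgc : Continuous g := holder_meas hθ0 hg
  have hφm := meas_fracP α 0 hf
  have hΦm := meas_PhiM α hf
  have hψm : ∀ b, Measurable (fracDerivM α b g) := fun b => meas_fracM α b hgc.measurable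
  have hφ : ∀ x, 0 < x → ‖fracDerivP α 0 f x‖ₑ ≤ ENNReal.ofReal c1 * PhiM α f x := by
    intro x hx; rw [hc1]; exact fracP_bound hα0 hα1 f hx
  have hψ : ∀ b ∈ Icc 0 T, ∀ x ∈ Ioo 0 b, ‖fracDerivM α b g x‖ₑ ≤ ENNReal.ofReal (c2 * G) := by
    intro b hb x hx; rw [hc2]
    exact fracM_bound hα0 hα1 hθ hG hg hx.2 (by linarith [hb.2, hx.1])
  have hprod : ∀ b ∈ Icc 0 T, ∀ x ∈ Ioo 0 b, ‖fracDerivP α 0 f x * fracDerivM α b g x‖ₑ ≤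
      ENNReal.ofReal (c1 * (c2 * G)) * PhiM α f x := by
    intro b hb x hx
    rw [enorm_mul, ENNReal.ofReal_mul hc10, mul_right_comm]
    exact mul_le_mul' (hφ x hx.1) (hψ b hb x hx)
  have hInt : ∀ b ∈ Icc 0 T, IntegrableOn (fun x => fracDerivP α 0 f x * fracDerivM α b g x) (Ioo 0 b) := by
    intro b hb
    refine ⟨(hφm.mul (hψm b)).aestronglyMeasurable, ?_⟩
    refine (setLIntegral_mono' measurableSet_Ioo (hprod b hb)).trans_lt ?_
    rw [lintegral_const_mul _ hΦm]
    refine ENNReal.mul_lt_top ENNReal.ofReal_lt_top (lt_of_le_of_lt ?_ hfin)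
    exact lintegral_mono_set (Ioo_subset_Ioo_right hb.2)
  have hinc : ∀ s ∈ Ioo 0 t, ‖glsIntegral α 0 t f g - glsIntegral α 0 s f g‖ₑ ≤
      ENNReal.ofReal (c1 * (c2 * G)) * (∫⁻ x in Ioo s t, PhiM α f x) +
      ENNReal.ofReal (c1 * (c3 * G)) *
        ∫⁻ x in Ioo 0 s, PhiM α f x * ENNReal.ofReal ((t - s) ^ θ * (s - x) ^ (-(1 - α))) := by
    intro s hs
    have hsT : s ∈ Icc 0 T := ⟨hs.1.le, hs.2.le.trans ht.2⟩
    have hi0 : IntegrableOn (fun x => fracDerivP α 0 f x * fracDerivM α t g x) (Ioo 0 s) :=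
      (hInt t ht).mono_set (Ioo_subset_Ioo_right hs.2.le)
    have hi1 : IntegrableOn (fun x => fracDerivP α 0 f x * fracDerivM α t g x) (Ioc 0 s) :=
      (hInt t ht).mono_set fun x hx => ⟨hx.1, hx.2.trans_lt hs.2⟩
    have hi2 : IntegrableOn (fun x => fracDerivP α 0 f x * fracDerivM α t g x) (Ioo s t) :=
      (hInt t ht).mono_set fun x hx => ⟨hs.1.trans hx.1, hx.2⟩
    have e : glsIntegral α 0 t f g - glsIntegral α 0 s f g =
        (∫ x in Ioo s t, fracDerivP α 0 f x * fracDerivM α t g x) +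
        ∫ x in Ioo 0 s, fracDerivP α 0 f x * (fracDerivM α t g x - fracDerivM α s g x) := by
      have e1 : glsIntegral α 0 t f g = (∫ x in Ioo 0 s, fracDerivP α 0 f x * fracDerivM α t g x) +
          ∫ x in Ioo s t, fracDerivP α 0 f x * fracDerivM α t g x := by
        unfold glsIntegral
        rw [← Ioc_union_Ioo_eq_Ioo hs.1.le hs.2, setIntegral_union _ measurableSet_Ioo hi1 hi2,
          integral_Ioc_eq_integral_Ioo]
        rw [Set.disjoint_left]
        intro u hu hu2
        exact absurd hu.2 (not_le.2 hu2.1)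
      have e2 : ∫ x in Ioo 0 s, fracDerivP α 0 f x * (fracDerivM α t g x - fracDerivM α s g x) =
          (∫ x in Ioo 0 s, fracDerivP α 0 f x * fracDerivM α t g x) - glsIntegral α 0 s f g := by
        unfold glsIntegral
        rw [← integral_sub hi0 (hInt s hsT)]
        simp_rw [mul_sub]
      rw [e1, e2]; ring
    rw [e]
    refine (enorm_add_le _ _).trans (add_le_add ?_ ?_)
    · refine (enorm_integral_le_lintegral_enorm _).trans ?_
      rw [← lintegral_const_mul _ hΦm]
      exact setLIntegral_mono' measurableSet_Ioo fun x hx => hprod t ht x ⟨hs.1.trans hx.1, hx.2⟩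
    · refine (enorm_integral_le_lintegral_enorm _).trans ?_
      rw [← lintegral_const_mul _ (by fun_prop)]
      refine setLIntegral_mono' measurableSet_Ioo fun x hx => ?_
      rw [enorm_mul, ENNReal.ofReal_mul hc10]
      have h1 := hφ x hx.1
      have h2 := fracM_diff_bound hα0 hα1 hθ hG hg hx.2 hs.2
      rw [← hc3] at h2
      refine (mul_le_mul' h1 h2).trans (le_of_eq ?_)
      ring
  constructor
  · have h1 : ENNReal.ofReal |glsIntegral α 0 t f g| ≤ ENNReal.ofReal (c1 * (c2 * G)) * ∫⁻ x in Ioo 0 t, PhiM α f x := by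
      rw [← Real.norm_eq_abs, ofReal_norm, ← lintegral_const_mul _ hΦm]
      refine (enorm_integral_le_lintegral_enorm _).trans ?_
      exact setLIntegral_mono' measurableSet_Ioo (hprod t ht)
    refine h1.trans (mul_le_mul_left (ENNReal.ofReal_le_ofReal ?_) _)
    have : 0 ≤ c1 * (c2 * (1 / α) + c3 * c4) * G := by positivity
    linarith
  · set I := ∫⁻ x in Ioo 0 t, PhiM α f x * ENNReal.ofReal ((t - x) ^ (-α)) with hI
    have hm1 : Measurable fun s => ∫⁻ x in Ioo s t, PhiM α f x := by
      have e : (fun s => ∫⁻ x in Ioo s t, PhiM α f x) =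
          fun s => ∫⁻ x, Function.curry ({p : ℝ × ℝ | p.1 < p.2 ∧ p.2 < t}.indicator
            (fun p => PhiM α f p.2)) s x := by
        funext s
        rw [← lintegral_indicator measurableSet_Ioo]
        rfl
      rw [e]
      apply Measurable.lintegral_prod_right
      exact Measurable.indicator (by fun_prop) (measurableSet_tri' t)
    calc pathNorm α (fun s => glsIntegral α 0 s f g) t
        ≤ ∫⁻ s in Ioo 0 t, (ENNReal.ofReal (c1 * (c2 * G)) *
            ((∫⁻ x in Ioo s t, PhiM α f x) * ENNReal.ofReal ((t - s) ^ (-1 - α))) +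
          ENNReal.ofReal (c1 * (c3 * G)) *
            ((∫⁻ x in Ioo 0 s, PhiM α f x * ENNReal.ofReal ((t - s) ^ θ * (s - x) ^ (-(1 - α)))) *
              ENNReal.ofReal ((t - s) ^ (-1 - α)))) := by
          unfold pathNorm
          refine setLIntegral_mono' measurableSet_Ioo fun s hs => ?_
          rw [ENNReal.ofReal_mul (abs_nonneg _), ← Real.norm_eq_abs, ofReal_norm]
          refine (mul_le_mul_left (hinc s hs) _).trans (le_of_eq ?_)
          ring
      _ ≤ ENNReal.ofReal (c1 * (c2 * G)) * (ENNReal.ofReal (1 / α) * I) +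
          ENNReal.ofReal (c1 * (c3 * G)) * (ENNReal.ofReal c4 * I) := by
          rw [lintegral_add_left (by fun_prop), lintegral_const_mul _ (by fun_prop),
            lintegral_const_mul' _ _ ENNReal.ofReal_ne_top]
          refine add_le_add (mul_le_mul_right (ton1 hα0 hΦm) _) (mul_le_mul_right ?_ _)
          rw [hc4]
          exact ton2 hα0 hα hθ hθ1 ht.2 hΦm
      _ ≤ _ := by
          have e : ∀ x y z w i : ℝ≥0∞, x * (y * i) + z * (w * i) = (x * y + z * w) * i := by
            intros; ring
          rw [e]
          refine mul_le_mul_left ?_ _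
          rw [← ENNReal.ofReal_mul (by positivity), ← ENNReal.ofReal_mul (by positivity),
            ← ENNReal.ofReal_add (by positivity) (by positivity)]
          apply ENNReal.ofReal_le_ofReal
          have : 0 ≤ c1 * c2 * G := by positivity
          linarith

/-! ### Pathwise estimate -/

lemma meas_tail {Φ : ℝ → ℝ≥0∞} (hΦ : Measurable Φ) (t : ℝ) :
    Measurable fun s => ∫⁻ x in Ioo s t, Φ x := by
  have e : (fun s => ∫⁻ x in Ioo s t, Φ x) =
      fun s => ∫⁻ x, Function.curry ({p : ℝ × ℝ | p.1 < p.2 ∧ p.2 < t}.indicator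
        (fun p => Φ p.2)) s x := by
    funext s
    rw [← lintegral_indicator measurableSet_Ioo]
    rfl
  rw [e]
  apply Measurable.lintegral_prod_right
  exact Measurable.indicator (by fun_prop) (measurableSet_tri' t)

lemma holder_kernel {α η L t : ℝ} (hαη : α < η) (hL : 0 ≤ L) (ht : 0 ≤ t) :
    ∫⁻ s in Ioo 0 t, ENNReal.ofReal (L * (t - s) ^ η * (t - s) ^ (-1 - α)) =
      ENNReal.ofReal (L * (t ^ (η - α) / (η - α))) := by
  calc _ = ∫⁻ s in Ioo 0 t, ENNReal.ofReal L * ENNReal.ofReal ((t - s) ^ (-(1 + α - η))) := by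
        refine setLIntegral_congr_fun measurableSet_Ioo fun s hs => ?_
        have hts : 0 < t - s := by linarith [hs.2]
        rw [← ENNReal.ofReal_mul hL, mul_assoc, ← Real.rpow_add hts]
        ring_nf
    _ = _ := by
        rw [lintegral_const_mul _ (by fun_prop), pw_right ht (by linarith), ← ENNReal.ofReal_mul hL]
        have e : 1 - (1 + α - η) = η - α := by ring
        rw [e, sub_zero]

lemma pathNorm_holder {α η L t : ℝ} (hαη : α < η) (hL : 0 ≤ L) (ht : 0 ≤ t) (f : ℝ → ℝ)
    (h : ∀ s ∈ Ioo 0 t, |f t - f s| ≤ L * (t - s) ^ η) :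
    pathNorm α f t ≤ ENNReal.ofReal (L * (t ^ (η - α) / (η - α))) := by
  rw [← holder_kernel hαη hL ht]
  refine setLIntegral_mono' measurableSet_Ioo fun s hs => ?_
  have hts : 0 < t - s := by linarith [hs.2]
  apply ENNReal.ofReal_le_ofReal
  exact mul_le_mul_of_nonneg_right (h s hs) (by positivity)

lemma pathNorm_comp {α β M t : ℝ} (hαβ : α < β) (hM : 0 ≤ M) (ht : 0 ≤ t) (f x : ℝ → ℝ)
    (h : ∀ s ∈ Ioo 0 t, |f t - f s| ≤ M * (t - s) ^ β + M * |x t - x s|) :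
    pathNorm α f t ≤ ENNReal.ofReal (M * (t ^ (β - α) / (β - α))) + ENNReal.ofReal M * pathNorm α x t := by
  rw [← holder_kernel hαβ hM ht]
  unfold pathNorm
  rw [← lintegral_const_mul' _ _ ENNReal.ofReal_ne_top, ← lintegral_add_left (by fun_prop)]
  refine setLIntegral_mono' measurableSet_Ioo fun s hs => ?_
  have hts : 0 < t - s := by linarith [hs.2]
  rw [← ENNReal.ofReal_mul hM, ← ENNReal.ofReal_add (by positivity) (by positivity)]
  apply ENNReal.ofReal_le_ofReal
  refine (mul_le_mul_of_nonneg_right (h s hs) (by positivity)).trans (le_of_eq ?_)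
  ring

/-- The drift part. -/
lemma drift_est {α t : ℝ} (hα : 0 < α) {b : ℝ → ℝ} (hb : Continuous b) {x y : ℝ → ℝ}
    (hxy : ∀ s ∈ Ioc 0 t, x s - y s = ∫ r in Ioo 0 s, b r) :
    pathNorm α x t ≤ ENNReal.ofReal (1 / α) *
      (∫⁻ r in Ioo 0 t, ENNReal.ofReal |b r| * ENNReal.ofReal ((t - r) ^ (-α))) + pathNorm α y t := by
  have hm : Measurable fun r => ENNReal.ofReal |b r| := by fun_prop
  refine le_trans ?_ (add_le_add_left (ton1 hα hm) _)
  have hm2 := meas_tail hm t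
  unfold pathNorm
  rw [← lintegral_add_left (by fun_prop)]
  refine setLIntegral_mono' measurableSet_Ioo fun s hs => ?_
  have hts : 0 < t - s := by linarith [hs.2]
  rw [ENNReal.ofReal_mul (abs_nonneg _), ENNReal.ofReal_mul (abs_nonneg _), ← add_mul]
  refine mul_le_mul_left ?_ _
  have hI : ∀ u v : ℝ, IntegrableOn b (Ioc u v) := fun u v =>
    (hb.integrableOn_Icc (a := u) (b := v)).mono_set Ioc_subset_Icc_self
  have e : x t - x s = (∫ r in Ioo s t, b r) + (y t - y s) := by
    have h1 := hxy t ⟨hs.1.trans hs.2, le_rfl⟩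
    have h2 := hxy s ⟨hs.1, hs.2.le⟩
    have h3 : ∫ r in Ioo 0 t, b r = (∫ r in Ioo 0 s, b r) + ∫ r in Ioo s t, b r := by
      rw [← integral_Ioc_eq_integral_Ioo, ← integral_Ioc_eq_integral_Ioo, ← integral_Ioc_eq_integral_Ioo,
        ← Ioc_union_Ioc_eq_Ioc hs.1.le hs.2.le, setIntegral_union _ measurableSet_Ioc (hI _ _) (hI _ _)]
      rw [Set.disjoint_left]
      intro u hu hu2
      exact absurd hu.2 (not_le.2 hu2.1)
    linarith
  rw [e]
  refine (ENNReal.ofReal_le_ofReal (abs_add_le _ _)).trans ?_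
  rw [ENNReal.ofReal_add (abs_nonneg _) (abs_nonneg _)]
  refine add_le_add_left ?_ _
  have := enorm_integral_le_lintegral_enorm (μ := volume.restrict (Ioo s t)) b
  simpa [← ofReal_norm] using this

lemma path_est {α θ T M β κ : ℝ} (hα0 : 0 < α) (hα : α < 1 / 2) (hθ : 1 - α < θ) (hθ1 : θ ≤ 1)
    (hT : 0 < T) (hM : 0 ≤ M) (hαβ : α < β) (hακ : α < κ) :
    ∃ C1 : ℝ, 0 ≤ C1 ∧ ∀ (x g f b : ℝ → ℝ) (G L X0 : ℝ), 0 ≤ G → 0 ≤ L →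
      (∀ s t, |g s - g t| ≤ G * |s - t| ^ θ) → Continuous f → Continuous b →
      (∀ s ∈ Icc 0 T, ∀ t ∈ Icc 0 T, |x t - x s| ≤ L * |t - s| ^ κ) →
      (∀ t ∈ Icc 0 T, |b t| ≤ M * (1 + |x t|)) →
      (∀ t ∈ Icc 0 T, |f t| ≤ M * (1 + |x t|)) →
      (∀ t ∈ Icc 0 T, ∀ s ∈ Icc 0 T, |f t - f s| ≤ M * |t - s| ^ β + M * |x t - x s|) →
      (∀ t ∈ Icc 0 T, x t = X0 + (∫ r in Ioo 0 t, b r) + glsIntegral α 0 t f g) →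
      ∀ lam : ℝ, 1 ≤ lam → (C1 * (1 + G)) * (4 * (1 / (1 - 2 * α) + 1)) * lam ^ (α - 1) ≤ 1 / 2 →
      ∀ t ∈ Icc 0 T, ENNReal.ofReal |x t| ≤ ENNReal.ofReal (2 * (1 + |X0|) * Real.exp (lam * T)) ∧
        pathNorm α x t ≤ ENNReal.ofReal (2 * (1 + |X0|) * lam ^ α * Real.exp (lam * T)) := by
  obtain ⟨C, hC0, hC⟩ := gls_est hα0 hα hθ hθ1 hT
  have hβα : 0 < β - α := by linarith
  have hκα : 0 < κ - α := by linarith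
  obtain ⟨D, hD⟩ : ∃ D, D = M * (1 + T ^ β / (β - α)) := ⟨_, rfl⟩
  have hD0 : 0 ≤ D := by rw [hD]; positivity
  obtain ⟨E, hE⟩ : ∃ E, E = M * T ^ α := ⟨_, rfl⟩
  have hE0 : 0 ≤ E := by rw [hE]; positivity
  refine ⟨E * (1 + 1 / α) + C * D, by positivity, ?_⟩
  intro x g f b G L X0 hG hL hg hf hb hx hbb hff hfh hsol lam hlam hlK
  set K := (E * (1 + 1 / α) + C * D) * (1 + G) with hK
  have hK0 : 0 ≤ K := by positivity
  set u : ℝ → ℝ≥0∞ := fun r => ENNReal.ofReal (1 + |x r|) with hu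
  set v : ℝ → ℝ≥0∞ := fun r => pathNorm α x r with hv
  set W : ℝ → ℝ≥0∞ := fun r => ENNReal.ofReal (r ^ (-α)) * u r + v r with hW
  have hPhi : ∀ r ∈ Ioo 0 T, PhiM α f r ≤ ENNReal.ofReal D * W r := by
    intro r hr
    have hr' : r ∈ Icc 0 T := ⟨hr.1.le, hr.2.le⟩
    have hr0 := hr.1
    have h1 := pathNorm_comp hαβ hM hr.1.le f x (fun s hs => by
      have := hfh r hr' s ⟨hs.1.le, (hs.2.trans hr.2).le⟩
      rwa [abs_of_pos (by linarith [hs.2] : 0 < r - s)] at this)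
    unfold PhiM
    have h2 : ENNReal.ofReal (|f r| * r ^ (-α)) + ENNReal.ofReal (M * (r ^ (β - α) / (β - α))) ≤
        ENNReal.ofReal D * (ENNReal.ofReal (r ^ (-α)) * u r) := by
      rw [hu, ← ENNReal.ofReal_mul (by positivity), ← ENNReal.ofReal_mul hD0,
        ← ENNReal.ofReal_add (by positivity) (by positivity)]
      apply ENNReal.ofReal_le_ofReal
      have e : r ^ (β - α) = r ^ β * r ^ (-α) := by rw [← Real.rpow_add hr0]; ring_nf
      have h3 : r ^ β ≤ T ^ β := Real.rpow_le_rpow hr0.le hr.2.le (by linarith)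
      rw [e, hD]
      have h4 := hff r hr'
      have h5 : 0 ≤ r ^ (-α) := by positivity
      calc |f r| * r ^ (-α) + M * (r ^ β * r ^ (-α) / (β - α)) ≤
          (M * (1 + |x r|)) * r ^ (-α) + M * (T ^ β * r ^ (-α) / (β - α)) * (1 + |x r|) := by
            refine add_le_add (by gcongr) ?_
            refine le_trans ?_ (le_mul_of_one_le_right (by positivity) (by linarith [abs_nonneg (x r)]))
            gcongr
        _ = _ := by ring
    calc _ ≤ ENNReal.ofReal (|f r| * r ^ (-α)) + (ENNReal.ofReal (M * (r ^ (β - α) / (β - α))) +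
          ENNReal.ofReal M * pathNorm α x r) := add_le_add_right h1 _
      _ = (ENNReal.ofReal (|f r| * r ^ (-α)) + ENNReal.ofReal (M * (r ^ (β - α) / (β - α)))) +
          ENNReal.ofReal M * pathNorm α x r := (add_assoc _ _ _).symm
      _ ≤ ENNReal.ofReal D * (ENNReal.ofReal (r ^ (-α)) * u r) + ENNReal.ofReal D * v r := by
          refine add_le_add h2 (mul_le_mul_left (ENNReal.ofReal_le_ofReal ?_) _)
          rw [hD]
          exact le_mul_of_one_le_right hM (by have : 0 ≤ T ^ β / (β - α) := by positivity
                                              linarith)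
      _ = _ := by rw [hW, mul_add]
  have hbW : ∀ r ∈ Ioo 0 T, ENNReal.ofReal |b r| ≤ ENNReal.ofReal E * W r := by
    intro r hr
    have hr' : r ∈ Icc 0 T := ⟨hr.1.le, hr.2.le⟩
    have hr0 := hr.1
    refine le_trans ?_ (mul_le_mul_right (le_add_of_nonneg_right zero_le) _)
    rw [hu, ← ENNReal.ofReal_mul (by positivity), ← ENNReal.ofReal_mul hE0]
    apply ENNReal.ofReal_le_ofReal
    refine (hbb r hr').trans ?_
    have h1 : 1 ≤ T ^ α * r ^ (-α) := by
      rw [Real.rpow_neg hr0.le, ← div_eq_mul_inv, one_le_div (by positivity)]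
      exact Real.rpow_le_rpow hr0.le hr.2.le hα0.le
    rw [hE]
    calc M * (1 + |x r|) ≤ M * (1 + |x r|) * (T ^ α * r ^ (-α)) := le_mul_of_one_le_right (by positivity) h1
      _ = _ := by ring
  obtain ⟨R, hR⟩ : ∃ R, R = 1 + |x 0| + L * T ^ κ + L * (T ^ (κ - α) / (κ - α)) := ⟨_, rfl⟩
  have hR0 : 0 ≤ R := by rw [hR]; positivity
  have hu1 : ∀ t ∈ Icc 0 T, u t ≤ ENNReal.ofReal R := by
    intro t ht
    apply ENNReal.ofReal_le_ofReal
    have h1 := hx 0 ⟨le_rfl, hT.le⟩ t ht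
    rw [sub_zero, abs_of_nonneg ht.1] at h1
    have h2 : t ^ κ ≤ T ^ κ := Real.rpow_le_rpow ht.1 ht.2 (by linarith)
    have h3 := mul_le_mul_of_nonneg_left h2 hL
    have h4 : |x t| ≤ |x t - x 0| + |x 0| := by
      have := abs_add_le (x t - x 0) (x 0); simpa using this
    have h5 : 0 ≤ L * (T ^ (κ - α) / (κ - α)) := by positivity
    rw [hR]; linarith
  have hv1 : ∀ t ∈ Icc 0 T, v t ≤ ENNReal.ofReal R := by
    intro t ht
    have ht0 := ht.1
    refine (pathNorm_holder hακ hL ht.1 x (fun s hs => ?_)).trans (ENNReal.ofReal_le_ofReal ?_)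
    · have := hx s ⟨hs.1.le, hs.2.le.trans ht.2⟩ t ht
      rwa [abs_of_pos (by linarith [hs.2] : 0 < t - s)] at this
    · have h2 : t ^ (κ - α) ≤ T ^ (κ - α) := Real.rpow_le_rpow ht.1 ht.2 (by linarith)
      have h3 : L * (t ^ (κ - α) / (κ - α)) ≤ L * (T ^ (κ - α) / (κ - α)) := by gcongr
      have h4 : 0 ≤ L * T ^ κ := by positivity
      rw [hR]; linarith [abs_nonneg (x 0)]
  have hfin : (∫⁻ r in Ioo 0 T, PhiM α f r) < ⊤ := by
    calc _ ≤ ∫⁻ r in Ioo 0 T, (ENNReal.ofReal D * (ENNReal.ofReal ((r - 0) ^ (-α)) * ENNReal.ofReal R + ENNReal.ofReal R)) := by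
          refine setLIntegral_mono' measurableSet_Ioo fun r hr => ?_
          have hr' : r ∈ Icc 0 T := ⟨hr.1.le, hr.2.le⟩
          refine (hPhi r hr).trans (mul_le_mul_right ?_ _)
          rw [sub_zero]
          exact add_le_add (mul_le_mul_right (hu1 r hr') _) (hv1 r hr')
      _ < ⊤ := by
          rw [lintegral_const_mul _ (by fun_prop), lintegral_add_left (by fun_prop), lintegral_mul_const _ (by fun_prop),
            pw_left hT.le (by linarith)]
          refine ENNReal.mul_lt_top ENNReal.ofReal_lt_top (ENNReal.add_lt_top.2 ⟨ENNReal.mul_lt_top ENNReal.ofReal_lt_top ENNReal.ofReal_lt_top, ?_⟩)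
          rw [lintegral_const]
          exact ENNReal.mul_lt_top ENNReal.ofReal_lt_top (by simp)
  have hCt := hC f g G hG hf.measurable hg hfin
  have hcoef1 : E + C * G * D ≤ K := by
    have h1 : 0 ≤ E * (1 / α) := by positivity
    have h2 : 0 ≤ E * G := by positivity
    have h3 : 0 ≤ E * (1 / α) * G := by positivity
    have h4 : 0 ≤ C * D := by positivity
    rw [hK]; nlinarith
  have hcoef2 : 1 / α * E + C * G * D ≤ K := by
    have h1 : 0 ≤ E * (1 / α) := by positivity
    have h2 : 0 ≤ E * G := by positivity
    have h3 : 0 ≤ E * (1 / α) * G := by positivity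
    have h4 : 0 ≤ C * D := by positivity
    rw [hK]; nlinarith
  have key := gron (α := α) (T := T) (K := K) (K0 := 1 + |X0|) (lam := lam) hα0 hα hK0 (by positivity) hlam hlK u v R
    ?_ ?_ hu1 hv1
  · intro t ht
    refine ⟨le_trans (ENNReal.ofReal_le_ofReal (by linarith)) (key t ht).1, (key t ht).2⟩
  · intro t ht
    have hs1 : ∀ r ∈ Ioo 0 t, r ∈ Ioo 0 T := fun r hr => ⟨hr.1, hr.2.trans_le ht.2⟩
    have h1 : u t ≤ ENNReal.ofReal (1 + |X0|) + (ENNReal.ofReal |∫ r in Ioo 0 t, b r| +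
        ENNReal.ofReal |glsIntegral α 0 t f g|) := by
      rw [hu, ← ENNReal.ofReal_add (by positivity) (by positivity), ← ENNReal.ofReal_add (by positivity) (by positivity)]
      apply ENNReal.ofReal_le_ofReal
      have h2 := abs_add_le (X0 + (∫ r in Ioo 0 t, b r)) (glsIntegral α 0 t f g)
      have h3 := abs_add_le X0 (∫ r in Ioo 0 t, b r)
      rw [← hsol t ht] at h2
      linarith
    refine h1.trans (add_le_add_right ?_ _)
    calc _ ≤ ENNReal.ofReal E * (∫⁻ r in Ioo 0 t, W r) +
          ENNReal.ofReal (C * G) * (ENNReal.ofReal D * ∫⁻ r in Ioo 0 t, W r) := by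
          refine add_le_add ?_ ((hCt t ht).1.trans (mul_le_mul_right ?_ _))
          · have := enorm_integral_le_lintegral_enorm (μ := volume.restrict (Ioo 0 t)) b
            simp only [← ofReal_norm, Real.norm_eq_abs] at this
            refine this.trans ?_
            rw [← lintegral_const_mul' _ _ ENNReal.ofReal_ne_top]
            exact setLIntegral_mono' measurableSet_Ioo fun r hr => hbW r (hs1 r hr)
          · rw [← lintegral_const_mul' _ _ ENNReal.ofReal_ne_top]
            exact setLIntegral_mono' measurableSet_Ioo fun r hr => hPhi r (hs1 r hr)
      _ = ENNReal.ofReal (E + C * G * D) * ∫⁻ r in Ioo 0 t, W r := by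
          rw [ENNReal.ofReal_add (by positivity) (by positivity), ENNReal.ofReal_mul (by positivity : 0 ≤ C * G)]
          ring
      _ ≤ _ := mul_le_mul_left (ENNReal.ofReal_le_ofReal hcoef1) _
  · intro t ht
    have hs1 : ∀ r ∈ Ioo 0 t, r ∈ Ioo 0 T := fun r hr => ⟨hr.1, hr.2.trans_le ht.2⟩
    have h1 := drift_est (α := α) (t := t) hα0 hb (x := x) (y := fun s => X0 + glsIntegral α 0 s f g) (by
      intro s hs
      have := hsol s ⟨hs.1.le, hs.2.trans ht.2⟩
      linarith)
    have h2 : pathNorm α (fun s => X0 + glsIntegral α 0 s f g) t = pathNorm α (fun s => glsIntegral α 0 s f g) t := by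
      unfold pathNorm; simp only [add_sub_add_left_eq_sub]
    rw [h2] at h1
    refine h1.trans ?_
    calc _ ≤ ENNReal.ofReal (1 / α) * (ENNReal.ofReal E * ∫⁻ r in Ioo 0 t, W r * ENNReal.ofReal ((t - r) ^ (-α))) +
          ENNReal.ofReal (C * G) * (ENNReal.ofReal D * ∫⁻ r in Ioo 0 t, W r * ENNReal.ofReal ((t - r) ^ (-α))) := by
          refine add_le_add (mul_le_mul_right ?_ _) ((hCt t ht).2.trans (mul_le_mul_right ?_ _))
          · rw [← lintegral_const_mul' _ _ ENNReal.ofReal_ne_top]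
            refine setLIntegral_mono' measurableSet_Ioo fun r hr => ?_
            rw [← mul_assoc]
            exact mul_le_mul_left (hbW r (hs1 r hr)) _
          · rw [← lintegral_const_mul' _ _ ENNReal.ofReal_ne_top]
            refine setLIntegral_mono' measurableSet_Ioo fun r hr => ?_
            rw [← mul_assoc]
            exact mul_le_mul_left (hPhi r (hs1 r hr)) _
      _ = ENNReal.ofReal (1 / α * E + C * G * D) * ∫⁻ r in Ioo 0 t, W r * ENNReal.ofReal ((t - r) ^ (-α)) := by
          rw [ENNReal.ofReal_add (by positivity) (by positivity), ENNReal.ofReal_mul (by positivity : 0 ≤ C * G),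
            ENNReal.ofReal_mul (by positivity : 0 ≤ 1 / α)]
          ring
      _ ≤ _ := mul_le_mul_left (ENNReal.ofReal_le_ofReal hcoef2) _

lemma gls_congr {α t : ℝ} {f f' g g' : ℝ → ℝ} (hf : ∀ s ∈ Icc 0 t, f s = f' s)
    (hg : ∀ s ∈ Icc 0 t, g s = g' s) : glsIntegral α 0 t f g = glsIntegral α 0 t f' g' := by
  unfold glsIntegral
  refine setIntegral_congr_fun measurableSet_Ioo fun x hx => ?_
  have ht : 0 ≤ t := by linarith [hx.1, hx.2]
  have h1 : fracDerivP α 0 f x = fracDerivP α 0 f' x := by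
    unfold fracDerivP
    have : ∫ u in Ioo 0 x, (f x - f u) / (x - u) ^ (1 + α) = ∫ u in Ioo 0 x, (f' x - f' u) / (x - u) ^ (1 + α) := by
      refine setIntegral_congr_fun measurableSet_Ioo fun u hu => ?_
      simp only [hf x ⟨hx.1.le, hx.2.le⟩, hf u ⟨hu.1.le, (hu.2.trans hx.2).le⟩]
    rw [this, hf x ⟨hx.1.le, hx.2.le⟩]
  have h2 : fracDerivM α t g x = fracDerivM α t g' x := by
    unfold fracDerivM
    have : ∫ u in Ioo x t, (g x - g u) / (u - x) ^ (2 - α) = ∫ u in Ioo x t, (g' x - g' u) / (u - x) ^ (2 - α) := by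
      refine setIntegral_congr_fun measurableSet_Ioo fun u hu => ?_
      simp only [hg x ⟨hx.1.le, hx.2.le⟩, hg u ⟨(hx.1.trans hu.1).le, hu.2.le⟩]
    rw [this, hg x ⟨hx.1.le, hx.2.le⟩, hg t ⟨ht, le_rfl⟩]
  simp only [h1, h2]

lemma cont_of_bound {h w : ℝ → ℝ} {M N β κ : ℝ} (hβ : 0 < β) (hκ : 0 < κ) (hw : Continuous w)
    (hh : ∀ s t, |h t - h s| ≤ M * |w t - w s| ^ β + N * |w t - w s| ^ κ) : Continuous h := by
  rw [continuous_iff_continuousAt]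
  intro s
  rw [ContinuousAt, tendsto_iff_dist_tendsto_zero]
  refine squeeze_zero (fun _ => dist_nonneg) (fun t => hh s t) ?_
  have hc : Continuous fun t => M * |w t - w s| ^ β + N * |w t - w s| ^ κ := by
    have h1 : Continuous fun t => |w t - w s| ^ β := Continuous.rpow_const (by fun_prop) (fun _ => Or.inr hβ.le)
    have h2 : Continuous fun t => |w t - w s| ^ κ := Continuous.rpow_const (by fun_prop) (fun _ => Or.inr hκ.le)
    fun_prop
  have := hc.tendsto s
  simpa [Real.zero_rpow hβ.ne', Real.zero_rpow hκ.ne'] using this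

lemma path_sup {α θ T M β κ : ℝ} (hα0 : 0 < α) (hα : α < 1 / 2) (hθ : 1 - α < θ) (hθ1 : θ ≤ 1)
    (hT : 0 < T) (hM : 0 ≤ M) (hαβ : α < β) (hακ : α < κ) (a c : ℝ → ℝ → ℝ) (X0 : ℝ)
    (hgrowth : ∀ t ∈ Set.Icc 0 T, ∀ x : ℝ, |a t x| + |c t x| ≤ M * (1 + |x|))
    (hlip : ∀ t ∈ Set.Icc 0 T, ∀ x y : ℝ,
      |a t x - a t y| + |c t x - c t y| ≤ M * |x - y|)
    (hhold : ∀ s ∈ Set.Icc 0 T, ∀ t ∈ Set.Icc 0 T, ∀ x : ℝ,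
      |a s x - a t x| + |c s x - c t x| ≤ M * |s - t| ^ β) :
    ∃ C2 : ℝ, 0 ≤ C2 ∧ ∀ (x g : ℝ → ℝ) (G L : ℝ), 0 ≤ G →
      (∀ s ∈ Icc 0 T, ∀ t ∈ Icc 0 T, |g t - g s| ≤ G * |t - s| ^ θ) →
      (∀ s ∈ Icc 0 T, ∀ t ∈ Icc 0 T, |x t - x s| ≤ L * |t - s| ^ κ) →
      (∀ t ∈ Icc 0 T, x t = X0 + (∫ r in Ioo 0 t, a r (x r)) + glsIntegral α 0 t (fun s => c s (x s)) g) →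
      supNorm α T x ≤ ENNReal.ofReal (4 * (1 + |X0|) * Real.exp ((T + 1) * (1 + C2 * (1 + G)) ^ (1 / (1 - α)))) := by
  obtain ⟨C1, hC1, hmain⟩ := path_est hα0 hα hθ hθ1 hT hM hαβ hακ
  obtain ⟨C0, hC0⟩ : ∃ C0, C0 = 4 * (1 / (1 - 2 * α) + 1) := ⟨_, rfl⟩
  have hC00 : 0 ≤ C0 := by
    have : 0 < 1 - 2 * α := by linarith
    rw [hC0]; positivity
  refine ⟨2 * (C1 * C0), by positivity, ?_⟩
  intro x g G L hG hg hx hsol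
  obtain ⟨pr, hpr⟩ : ∃ pr : ℝ → ℝ, pr = fun s => max 0 (min s T) := ⟨_, rfl⟩
  have hprm : ∀ s, pr s ∈ Icc 0 T := by
    intro s; rw [hpr]; exact ⟨le_max_left _ _, max_le hT.le (min_le_right _ _)⟩
  have hpre : ∀ s ∈ Icc 0 T, pr s = s := by
    intro s hs; rw [hpr]; simp [hs.1, hs.2]
  have hprc : Continuous pr := by rw [hpr]; fun_prop
  have hprl : ∀ s t, |pr s - pr t| ≤ |s - t| := by
    intro s t; rw [hpr]
    simp only
    have h1 := abs_max_sub_max_le_max 0 (min s T) 0 (min t T)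
    have h2 := abs_min_sub_min_le_max s T t T
    simp only [sub_self, abs_zero] at h1 h2
    rw [max_eq_right (abs_nonneg (min s T - min t T))] at h1
    rw [max_eq_left (abs_nonneg (s - t))] at h2
    exact h1.trans h2
  have hx' : ∀ s ∈ Icc 0 T, ∀ t ∈ Icc 0 T, |x t - x s| ≤ |L| * |t - s| ^ κ := fun s hs t ht =>
    (hx s hs t ht).trans (mul_le_mul_of_nonneg_right (le_abs_self L) (by positivity))
  have hcd : ∀ s ∈ Icc 0 T, ∀ t ∈ Icc 0 T, |a t (x t) - a s (x s)| + |c t (x t) - c s (x s)| ≤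
      M * |t - s| ^ β + M * |x t - x s| := by
    intro s hs t ht
    have h1 := hhold t ht s hs (x t)
    have h2 := hlip s hs (x t) (x s)
    have h3 := abs_sub_le (a t (x t)) (a s (x t)) (a s (x s))
    have h4 := abs_sub_le (c t (x t)) (c s (x t)) (c s (x s))
    linarith
  have hcd2 : ∀ s t, |a (pr t) (x (pr t)) - a (pr s) (x (pr s))| + |c (pr t) (x (pr t)) - c (pr s) (x (pr s))| ≤
      M * |pr t - pr s| ^ β + M * |L| * |pr t - pr s| ^ κ := by
    intro s t
    refine (hcd _ (hprm s) _ (hprm t)).trans ?_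
    have := mul_le_mul_of_nonneg_left (hx' _ (hprm s) _ (hprm t)) hM
    linarith
  have hfc : Continuous fun s => c (pr s) (x (pr s)) :=
    cont_of_bound (hα0.trans hαβ) (hα0.trans hακ) hprc fun s t =>
      (le_add_of_nonneg_left (abs_nonneg _)).trans (hcd2 s t)
  have hbc : Continuous fun s => a (pr s) (x (pr s)) :=
    cont_of_bound (hα0.trans hαβ) (hα0.trans hακ) hprc fun s t =>
      (le_add_of_nonneg_right (abs_nonneg _)).trans (hcd2 s t)
  obtain ⟨Q, hQ⟩ : ∃ Q, Q = 1 + 2 * (C1 * C0) * (1 + G) := ⟨_, rfl⟩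
  have hQ1 : 1 ≤ Q := by
    have : 0 ≤ 2 * (C1 * C0) * (1 + G) := by positivity
    linarith
  obtain ⟨lam, hlam⟩ : ∃ lam, lam = Q ^ (1 / (1 - α)) := ⟨_, rfl⟩
  have h1α : 0 < 1 - α := by linarith
  have hlam1 : 1 ≤ lam := by rw [hlam]; exact Real.one_le_rpow hQ1 (by positivity)
  have hlamQ : lam ^ (α - 1) = Q⁻¹ := by
    rw [hlam, ← Real.rpow_mul (by linarith), ← Real.rpow_neg_one]
    congr 1
    field_simp
    ring
  have key := hmain x (fun s => g (pr s)) (fun s => c (pr s) (x (pr s))) (fun s => a (pr s) (x (pr s)))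
    G |L| X0 hG (abs_nonneg _) ?_ hfc hbc hx' ?_ ?_ ?_ ?_ lam hlam1 ?_
  · rw [← hQ, ← hlam]
    have hA : 0 ≤ 1 + |X0| := by positivity
    have hl0 : 0 ≤ lam := by linarith
    unfold supNorm
    refine (add_le_add (iSup₂_le fun t ht => (key t ht).1) (iSup₂_le fun t ht => (key t ht).2)).trans ?_
    rw [← ENNReal.ofReal_add (by positivity) (by positivity)]
    apply ENNReal.ofReal_le_ofReal
    have e1 : lam ^ α ≤ Real.exp lam := by
      calc lam ^ α ≤ lam ^ (1 : ℝ) := Real.rpow_le_rpow_of_exponent_le hlam1 (by linarith)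
        _ = lam := Real.rpow_one _
        _ ≤ Real.exp lam := by linarith [Real.add_one_le_exp lam]
    have e2 : (1 : ℝ) ≤ Real.exp lam := Real.one_le_exp hl0
    have e3 : Real.exp ((T + 1) * lam) = Real.exp lam * Real.exp (lam * T) := by
      rw [← Real.exp_add]; ring_nf
    rw [e3]
    have e4 : 0 ≤ (1 + |X0|) * Real.exp (lam * T) := by positivity
    nlinarith [mul_le_mul_of_nonneg_left e1 e4, mul_le_mul_of_nonneg_left e2 e4]
  · intro s t
    refine (hg _ (hprm t) _ (hprm s)).trans ?_
    have := hprl s t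
    gcongr
    linarith
  · intro t ht
    rw [hpre t ht]
    linarith [hgrowth t ht (x t), abs_nonneg (c t (x t))]
  · intro t ht
    rw [hpre t ht]
    linarith [hgrowth t ht (x t), abs_nonneg (a t (x t))]
  · intro t ht s hs
    simp only [hpre t ht, hpre s hs]
    linarith [hcd s hs t ht, abs_nonneg (a t (x t) - a s (x s))]
  · intro t ht
    have hs1 : ∀ s ∈ Icc 0 t, pr s = s := fun s hs => hpre s ⟨hs.1, hs.2.trans ht.2⟩
    have e1 : glsIntegral α 0 t (fun s => c (pr s) (x (pr s))) (fun s => g (pr s)) =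
        glsIntegral α 0 t (fun s => c s (x s)) g :=
      gls_congr (fun s hs => by simp only [hs1 s hs]) (fun s hs => by simp only [hs1 s hs])
    have e2 : ∫ r in Ioo 0 t, a (pr r) (x (pr r)) = ∫ r in Ioo 0 t, a r (x r) :=
      setIntegral_congr_fun measurableSet_Ioo fun s hs => by simp only [hs1 s ⟨hs.1.le, hs.2.le⟩]
    rw [e1, e2]
    exact hsol t ht
  · rw [← hC0, hlamQ, ← div_eq_mul_inv, div_le_iff₀ (by linarith)]
    rw [hQ]; nlinarith

/-! ### Dyadic chaining -/

lemma dyadic_step {g : ℝ → ℝ} {q ρ t : ℝ} (ht : t ∈ Icc (0 : ℝ) 1) (hq : 0 ≤ q) (hρ : 0 ≤ ρ)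
    (h : ∀ n k : ℕ, k < 2 ^ n → |g ((k + 1) / 2 ^ n) - g (k / 2 ^ n)| ≤ q * ρ ^ n) (n : ℕ) :
    |g ((⌊(2 : ℝ) ^ n * t⌋₊ : ℝ) / 2 ^ n) - g ((⌊(2 : ℝ) ^ (n + 1) * t⌋₊ : ℝ) / 2 ^ (n + 1))| ≤ (q * ρ) * ρ ^ n := by
  set m := ⌊(2 : ℝ) ^ n * t⌋₊ with hm
  have h0 : 0 ≤ (2 : ℝ) ^ n * t := mul_nonneg (by positivity) ht.1
  have h1 : (m : ℝ) ≤ 2 ^ n * t := Nat.floor_le h0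
  have h2 : (2 : ℝ) ^ n * t < m + 1 := Nat.lt_floor_add_one _
  have hp : (0 : ℝ) < 2 ^ n := by positivity
  have e0 : (m : ℝ) / 2 ^ n = ((2 * m : ℕ) : ℝ) / 2 ^ (n + 1) := by
    rw [pow_succ]; push_cast; field_simp
  rw [e0]
  by_cases hc : (2 : ℝ) ^ (n + 1) * t < 2 * m + 1
  · have e1 : ⌊(2 : ℝ) ^ (n + 1) * t⌋₊ = 2 * m := by
      rw [Nat.floor_eq_iff (mul_nonneg (by positivity) ht.1)]
      push_cast
      refine ⟨?_, hc⟩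
      rw [pow_succ]; linarith
    rw [e1, sub_self, abs_zero]; positivity
  · have e1 : ⌊(2 : ℝ) ^ (n + 1) * t⌋₊ = 2 * m + 1 := by
      rw [Nat.floor_eq_iff (mul_nonneg (by positivity) ht.1)]
      push_cast
      refine ⟨by linarith, ?_⟩
      rw [pow_succ]; linarith
    have hlt : 2 * m < 2 ^ (n + 1) := by
      have : (2 * m + 1 : ℝ) ≤ 2 ^ (n + 1) :=
        (not_lt.1 hc).trans (mul_le_of_le_one_right (by positivity) ht.2)
      have h3 : 2 * m + 1 ≤ 2 ^ (n + 1) := by exact_mod_cast this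
      omega
    have := h (n + 1) (2 * m) hlt
    rw [e1, abs_sub_comm]
    push_cast at this ⊢
    rw [pow_succ ρ] at this
    linarith

lemma dyadic_lim {g : ℝ → ℝ} (hg : Continuous g) {q ρ t : ℝ} (ht : t ∈ Icc (0 : ℝ) 1) (hq : 0 ≤ q) (hρ : 0 ≤ ρ)
    (hρ1 : ρ < 1)
    (h : ∀ n k : ℕ, k < 2 ^ n → |g ((k + 1) / 2 ^ n) - g (k / 2 ^ n)| ≤ q * ρ ^ n) (n : ℕ) :
    |g ((⌊(2 : ℝ) ^ n * t⌋₊ : ℝ) / 2 ^ n) - g t| ≤ q * ρ * ρ ^ n / (1 - ρ) := by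
  have hl : Filter.Tendsto (fun n : ℕ => (⌊(2 : ℝ) ^ n * t⌋₊ : ℝ) / 2 ^ n) Filter.atTop (nhds t) := by
    have h1 := tendsto_nat_floor_mul_div_atTop (R := ℝ) ht.1
    have h2 := h1.comp (tendsto_pow_atTop_atTop_of_one_lt (one_lt_two : (1 : ℝ) < 2))
    refine h2.congr fun n => ?_
    simp [mul_comm]
  exact dist_le_of_le_geometric_of_tendsto ρ (q * ρ) hρ1 (f := fun n : ℕ => g ((⌊(2 : ℝ) ^ n * t⌋₊ : ℝ) / 2 ^ n))
    (fun n => dyadic_step ht hq hρ h n) ((hg.tendsto t).comp hl) n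

lemma dyadic {θ : ℝ} (hθ : 0 < θ) : ∃ C : ℝ, 0 ≤ C ∧ ∀ (g : ℝ → ℝ) (q : ℝ), Continuous g → 0 ≤ q →
    (∀ n k : ℕ, k < 2 ^ n → |g ((k + 1) / 2 ^ n) - g (k / 2 ^ n)| ≤ q * ((2 : ℝ) ^ (-θ)) ^ n) →
    ∀ s ∈ Icc (0 : ℝ) 1, ∀ t ∈ Icc (0 : ℝ) 1, |g t - g s| ≤ C * q * |t - s| ^ θ := by
  obtain ⟨ρ, hρ⟩ : ∃ ρ, ρ = (2 : ℝ) ^ (-θ) := ⟨_, rfl⟩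
  have hρ0 : 0 < ρ := by rw [hρ]; positivity
  have hρ1 : ρ < 1 := by rw [hρ]; exact Real.rpow_lt_one_of_one_lt_of_neg one_lt_two (by linarith)
  have h1ρ : 0 < 1 - ρ := by linarith
  refine ⟨ρ⁻¹ * (1 + 2 * (ρ / (1 - ρ))), by positivity, ?_⟩
  intro g q hg hq h
  rw [← hρ] at h
  have main : ∀ s ∈ Icc (0 : ℝ) 1, ∀ t ∈ Icc (0 : ℝ) 1, s < t →
      |g t - g s| ≤ ρ⁻¹ * (1 + 2 * (ρ / (1 - ρ))) * q * |t - s| ^ θ := by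
    intro s hs t ht hst
    have hts : 0 < t - s := by linarith
    obtain ⟨n, hn1, hn2⟩ := exists_nat_pow_near_of_lt_one hts (by linarith [hs.1, ht.2] : t - s ≤ 1)
      (by norm_num : (0 : ℝ) < 1 / 2) (by norm_num)
    have hp : (0 : ℝ) < 2 ^ n := by positivity
    have hρn : ρ ^ n ≤ ρ⁻¹ * (t - s) ^ θ := by
      have h1 : ρ ^ (n + 1) ≤ (t - s) ^ θ := by
        have e : ρ ^ (n + 1) = ((1 / 2 : ℝ) ^ (n + 1)) ^ θ := by
          rw [hρ, Real.rpow_neg (by norm_num), ← Real.inv_rpow (by norm_num), ← Real.rpow_natCast,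
            ← Real.rpow_mul (by norm_num), ← Real.rpow_natCast, ← Real.rpow_mul (by norm_num), mul_comm]
          norm_num
        rw [e]
        exact Real.rpow_le_rpow (by positivity) hn1.le hθ.le
      rw [pow_succ] at h1
      rw [inv_mul_eq_div, le_div_iff₀ hρ0]
      exact h1
    have hA := dyadic_lim hg ht hq hρ0.le hρ1 h n
    have hB := dyadic_lim hg hs hq hρ0.le hρ1 h n
    have hM : |g ((⌊(2 : ℝ) ^ n * t⌋₊ : ℝ) / 2 ^ n) - g ((⌊(2 : ℝ) ^ n * s⌋₊ : ℝ) / 2 ^ n)| ≤ q * ρ ^ n := by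
      set m := ⌊(2 : ℝ) ^ n * s⌋₊ with hm
      have h0 : 0 ≤ (2 : ℝ) ^ n * s := mul_nonneg (by positivity) hs.1
      have h0t : 0 ≤ (2 : ℝ) ^ n * t := mul_nonneg (by positivity) ht.1
      have h1 : (m : ℝ) ≤ 2 ^ n * s := Nat.floor_le h0
      have h2 : (2 : ℝ) ^ n * s < m + 1 := Nat.lt_floor_add_one _
      have h3 : (2 : ℝ) ^ n * t ≤ 2 ^ n * s + 1 := by
        have : (2 : ℝ) ^ n * (t - s) ≤ 1 := by
          refine (mul_le_mul_of_nonneg_left hn2 hp.le).trans (le_of_eq ?_)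
          rw [← mul_pow]; norm_num
        linarith
      have h4 : (2 : ℝ) ^ n * s < 2 ^ n * t := by gcongr
      by_cases hc : (2 : ℝ) ^ n * t < m + 1
      · have e1 : ⌊(2 : ℝ) ^ n * t⌋₊ = m := by
          rw [Nat.floor_eq_iff h0t]
          exact ⟨by linarith, hc⟩
        rw [e1, sub_self, abs_zero]; positivity
      · have e1 : ⌊(2 : ℝ) ^ n * t⌋₊ = m + 1 := by
          rw [Nat.floor_eq_iff h0t]
          push_cast
          exact ⟨by linarith, by linarith⟩
        have hlt : m < 2 ^ n := by
          have : (m + 1 : ℝ) ≤ 2 ^ n :=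
            (not_lt.1 hc).trans (mul_le_of_le_one_right (by positivity) ht.2)
          have h3 : m + 1 ≤ 2 ^ n := by exact_mod_cast this
          omega
        have := h n m hlt
        rw [e1]
        push_cast
        exact this
    rw [abs_of_pos hts]
    have hfin : |g t - g s| ≤ q * ρ * ρ ^ n / (1 - ρ) + q * ρ ^ n + q * ρ * ρ ^ n / (1 - ρ) := by
      rw [abs_sub_comm] at hA
      have h1 := abs_sub_le (g t) (g ((⌊(2 : ℝ) ^ n * t⌋₊ : ℝ) / 2 ^ n)) (g s)
      have h2 := abs_sub_le (g ((⌊(2 : ℝ) ^ n * t⌋₊ : ℝ) / 2 ^ n)) (g ((⌊(2 : ℝ) ^ n * s⌋₊ : ℝ) / 2 ^ n)) (g s)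
      linarith
    calc _ ≤ _ := hfin
      _ = (1 + 2 * (ρ / (1 - ρ))) * q * ρ ^ n := by ring
      _ ≤ (1 + 2 * (ρ / (1 - ρ))) * q * (ρ⁻¹ * (t - s) ^ θ) := by gcongr
      _ = _ := by ring
  intro s hs t ht
  rcases lt_trichotomy s t with hst | hst | hst
  · exact main s hs t ht hst
  · rw [hst, sub_self, abs_zero]; positivity
  · rw [abs_sub_comm, abs_sub_comm t s]; exact main t ht s hs hst

/-! ### Gaussian increments -/

lemma aem_of_map {Ω : Type*} [MeasurableSpace Ω] {P : Measure Ω} {f : Ω → ℝ} {v : ℝ≥0}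
    (h : Measure.map f P = ProbabilityTheory.gaussianReal 0 v) : AEMeasurable f P := by
  by_contra hn
  rw [Measure.map_of_not_aemeasurable hn] at h
  exact (IsProbabilityMeasure.ne_zero (ProbabilityTheory.gaussianReal 0 v)) h.symm

lemma memLp_of_map {Ω : Type*} [MeasurableSpace Ω] {P : Measure Ω} {f : Ω → ℝ} {v : ℝ≥0}
    (h : Measure.map f P = ProbabilityTheory.gaussianReal 0 v) : MemLp f 2 P := by
  have h1 : MemLp id 2 (Measure.map f P) := by
    rw [h]; exact ProbabilityTheory.memLp_id_gaussianReal 2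
  exact (memLp_map_measure_iff aestronglyMeasurable_id (aem_of_map h)).1 h1

lemma var_of_map {Ω : Type*} [MeasurableSpace Ω] {P : Measure Ω} {f : Ω → ℝ} {v : ℝ≥0}
    (h : Measure.map f P = ProbabilityTheory.gaussianReal 0 v) : ∫ ω, f ω ^ 2 ∂P = v := by
  have h1 : ∫ x, x ^ 2 ∂(Measure.map f P) = ∫ ω, f ω ^ 2 ∂P :=
    integral_map (aem_of_map h) (by fun_prop)
  rw [← h1, h]
  have h2 := ProbabilityTheory.variance_fun_id_gaussianReal (μ := 0) (v := v)
  rw [ProbabilityTheory.variance_of_integral_eq_zero (by fun_prop) (by simp)] at h2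
  exact h2

lemma fbm_incr {Ω : Type*} [MeasurableSpace Ω] {P : Measure Ω} {H : ℝ} {B : Ω → ℝ → ℝ} (hH : 0 < H)
    (hB : IsFBM P H B) {s t : ℝ} (hs : 0 ≤ s) (hst : s < t) :
    Measure.map (fun ω => (t - s) ^ (-H) * (B ω t - B ω s)) P = ProbabilityTheory.gaussianReal 0 1 := by
  obtain ⟨-, h2, h3⟩ := hB
  have hts : 0 < t - s := by linarith
  have hL : ∀ r, MemLp (fun ω => B ω r) 2 P := by
    intro r
    obtain ⟨v, hv⟩ := h2 1 (fun _ => 1) (fun _ => r)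
    simp only [Finset.univ_unique, Finset.sum_singleton, one_mul] at hv
    exact memLp_of_map hv
  obtain ⟨v, hv⟩ := h2 2 ![(t - s) ^ (-H), -(t - s) ^ (-H)] ![t, s]
  have e : (fun ω => ∑ i, (![(t - s) ^ (-H), -(t - s) ^ (-H)] : Fin 2 → ℝ) i * B ω ((![t, s] : Fin 2 → ℝ) i)) =
      fun ω => (t - s) ^ (-H) * (B ω t - B ω s) := by
    funext ω; simp [Fin.sum_univ_two]; ring
  rw [e] at hv
  rw [hv]
  have hvar := var_of_map hv
  have itt : Integrable (fun ω => B ω t * B ω t) P := (hL t).integrable_mul (hL t)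
  have its : Integrable (fun ω => B ω s * B ω t) P := (hL s).integrable_mul (hL t)
  have iss : Integrable (fun ω => B ω s * B ω s) P := (hL s).integrable_mul (hL s)
  have e2 : ∫ ω, ((t - s) ^ (-H) * (B ω t - B ω s)) ^ 2 ∂P = 1 := by
    have e3 : (fun ω => ((t - s) ^ (-H) * (B ω t - B ω s)) ^ 2) =
        fun ω => ((t - s) ^ (-H)) ^ 2 * (B ω t * B ω t - 2 * (B ω s * B ω t) + B ω s * B ω s) := by
      funext ω; ring
    have i2 : Integrable (fun ω => B ω t * B ω t - 2 * (B ω s * B ω t)) P := itt.sub (its.const_mul 2)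
    rw [e3, integral_const_mul, integral_add i2 iss, integral_sub itt (its.const_mul 2),
      integral_const_mul, h3 t t (by linarith) (by linarith), h3 s t hs (by linarith), h3 s s hs hs]
    have hz : (0 : ℝ) ^ (2 * H) = 0 := Real.zero_rpow (by linarith)
    rw [sub_self, sub_self, abs_zero, hz, abs_of_pos hts, ← Real.rpow_natCast, ← Real.rpow_mul hts.le]
    have e4 : (t - s) ^ (-H * ((2 : ℕ) : ℝ)) * (t - s) ^ (2 * H) = 1 := by
      rw [← Real.rpow_add hts]
      have : -H * ((2 : ℕ) : ℝ) + 2 * H = 0 := by push_cast; ring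
      rw [this, Real.rpow_zero]
    linear_combination e4
  rw [e2] at hvar
  congr 1
  exact_mod_cast hvar.symm

lemma gauss_exp : ∫⁻ x, ENNReal.ofReal (Real.exp (x ^ 2 / 4)) ∂(ProbabilityTheory.gaussianReal 0 1) < ⊤ := by
  rw [ProbabilityTheory.gaussianReal_of_var_ne_zero _ one_ne_zero,
    lintegral_withDensity_eq_lintegral_mul _ (ProbabilityTheory.measurable_gaussianPDF _ _) (by fun_prop)]
  have hI : Integrable fun x : ℝ => (√(2 * Real.pi * 1))⁻¹ * Real.exp (-(1 / 4) * x ^ 2) :=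
    (integrable_exp_neg_mul_sq (by norm_num)).const_mul _
  refine lt_of_le_of_lt (lintegral_mono fun x => ?_) hI.lintegral_lt_top
  simp only [Pi.mul_apply, ProbabilityTheory.gaussianPDF]
  rw [← ENNReal.ofReal_mul (ProbabilityTheory.gaussianPDFReal_nonneg _ _ _)]
  apply ENNReal.ofReal_le_ofReal
  rw [ProbabilityTheory.gaussianPDFReal, mul_assoc, ← Real.exp_add]
  apply le_of_eq
  simp only [NNReal.coe_one]
  congr 2
  ring

/-- The Orlicz-type function used for chaining. -/
noncomputable def phiO (J : ℕ) (y : ℝ) : ℝ := y ^ J * Real.exp y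

lemma gauss_phi (J : ℕ) :
    ∫⁻ x, ENNReal.ofReal (phiO J (x ^ 2 / 8)) ∂(ProbabilityTheory.gaussianReal 0 1) < ⊤ := by
  calc _ ≤ ∫⁻ x, ENNReal.ofReal (J.factorial) * ENNReal.ofReal (Real.exp (x ^ 2 / 4))
        ∂(ProbabilityTheory.gaussianReal 0 1) := by
        refine lintegral_mono fun x => ?_
        rw [← ENNReal.ofReal_mul (by positivity)]
        apply ENNReal.ofReal_le_ofReal
        have h1 := Real.pow_div_factorial_le_exp (x ^ 2 / 8) (by positivity) J
        rw [div_le_iff₀ (by positivity)] at h1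
        have h2 : Real.exp (x ^ 2 / 4) = Real.exp (x ^ 2 / 8) * Real.exp (x ^ 2 / 8) := by
          rw [← Real.exp_add]; ring_nf
        rw [h2, phiO]
        calc _ ≤ (Real.exp (x ^ 2 / 8) * J.factorial) * Real.exp (x ^ 2 / 8) := by gcongr
          _ = _ := by ring
    _ < ⊤ := by
        rw [lintegral_const_mul _ (by fun_prop)]
        exact ENNReal.mul_lt_top ENNReal.ofReal_lt_top gauss_exp

/-- The chaining sum. -/
noncomputable def chainS (J : ℕ) (z : ℕ → ℕ → ℝ) : ℝ≥0∞ :=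
  ∑' n : ℕ, ∑ k ∈ Finset.range (2 ^ n), ENNReal.ofReal ((1 / 4) ^ n) * ENNReal.ofReal (phiO J (z n k ^ 2 / 8))

lemma phiO_nonneg (J : ℕ) {y : ℝ} (hy : 0 ≤ y) : 0 ≤ phiO J y := by unfold phiO; positivity

lemma exp_le_phiO (J : ℕ) {y : ℝ} (hy : 0 ≤ y) : Real.exp y ≤ Real.exp 1 + phiO J y := by
  rcases le_total y 1 with h | h
  · have := phiO_nonneg J hy
    have h2 := Real.exp_le_exp.2 h
    linarith
  · have h1 : 1 ≤ y ^ J := one_le_pow₀ h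
    unfold phiO
    nlinarith [Real.exp_pos 1, Real.exp_pos y]

lemma chain_bound {η : ℝ} (hη : 0 < η) {J : ℕ} (hJ : 1 ≤ η * J) {z : ℕ → ℕ → ℝ} (hS : chainS J z < ⊤)
    {n k : ℕ} (hk : k < 2 ^ n) :
    ((2 : ℝ) ^ (-η)) ^ n * |z n k| ≤ √(8 * Real.log (Real.exp 1 + (chainS J z).toReal)) := by
  set y := z n k ^ 2 / 8 with hy
  have hy0 : 0 ≤ y := by positivity
  have h1 : (1 / 4 : ℝ) ^ n * phiO J y ≤ (chainS J z).toReal := by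
    rw [← ENNReal.ofReal_le_iff_le_toReal hS.ne, ENNReal.ofReal_mul (by positivity)]
    refine le_trans ?_ (ENNReal.le_tsum n)
    exact Finset.single_le_sum (f := fun k => ENNReal.ofReal ((1 / 4) ^ n) * ENNReal.ofReal (phiO J (z n k ^ 2 / 8)))
      (fun _ _ => zero_le) (Finset.mem_range.2 hk)
  set d := ((2 : ℝ) ^ (-η)) ^ n with hd
  have hd0 : 0 < d := by positivity
  have hd1 : d ≤ 1 := pow_le_one₀ (by positivity)
    (Real.rpow_le_one_of_one_le_of_nonpos one_le_two (by linarith))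
  have hdJ : (d ^ 2) ^ J ≤ (1 / 4) ^ n := by
    have e : (d ^ 2) ^ J = ((1 / 4 : ℝ) ^ (η * J)) ^ n := by
      have e1 : (2 : ℝ) ^ (-η) = (1 / 2 : ℝ) ^ η := by
        rw [Real.rpow_neg (by norm_num), ← Real.inv_rpow (by norm_num)]; norm_num
      have e2 : (1 / 4 : ℝ) = (1 / 2) ^ 2 := by norm_num
      rw [hd, e1, e2, Real.rpow_mul (by positivity), Real.rpow_natCast, ← Real.rpow_natCast (1 / 2 : ℝ) 2,
        ← Real.rpow_mul (by norm_num), mul_comm _ η, Real.rpow_mul (by norm_num), Real.rpow_natCast]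
      ring
    rw [e]
    refine pow_le_pow_left₀ (by positivity) ?_ n
    calc (1 / 4 : ℝ) ^ (η * J) ≤ (1 / 4 : ℝ) ^ (1 : ℝ) :=
          Real.rpow_le_rpow_of_exponent_ge (by norm_num) (by norm_num) hJ
      _ = 1 / 4 := Real.rpow_one _
  have hd21 : d ^ 2 ≤ 1 := pow_le_one₀ hd0.le hd1
  have h2 : phiO J (d ^ 2 * y) ≤ (chainS J z).toReal := by
    refine le_trans ?_ h1
    unfold phiO
    rw [mul_pow]
    calc (d ^ 2) ^ J * y ^ J * Real.exp (d ^ 2 * y) ≤ (1 / 4) ^ n * y ^ J * Real.exp y := by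
          gcongr
          exact mul_le_of_le_one_left hy0 hd21
      _ = _ := by ring
  have h3 : Real.exp (d ^ 2 * y) ≤ Real.exp 1 + (chainS J z).toReal :=
    (exp_le_phiO J (by positivity)).trans (by linarith)
  have h4 : d ^ 2 * y ≤ Real.log (Real.exp 1 + (chainS J z).toReal) := by
    rw [Real.le_log_iff_exp_le (lt_of_lt_of_le (Real.exp_pos _) h3)]
    exact h3
  apply Real.le_sqrt_of_sq_le
  rw [mul_pow, sq_abs]
  have : z n k ^ 2 = 8 * y := by rw [hy]; ring
  rw [this]; linarith

/-! ### Hölder constant of fractional Brownian motion -/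

lemma chain_int {Ω : Type*} [MeasurableSpace Ω] {P : Measure Ω} (J : ℕ) (Z : ℕ → ℕ → Ω → ℝ)
    (hZ : ∀ n k, Measure.map (Z n k) P = ProbabilityTheory.gaussianReal 0 1) :
    AEMeasurable (fun ω => chainS J (fun n k => Z n k ω)) P ∧
    ∫⁻ ω, chainS J (fun n k => Z n k ω) ∂P < ⊤ := by
  have hm : Measurable fun x : ℝ => ENNReal.ofReal (phiO J (x ^ 2 / 8)) := by
    unfold phiO; fun_prop
  have hZm : ∀ n k, AEMeasurable (fun ω => ENNReal.ofReal (phiO J (Z n k ω ^ 2 / 8))) P := fun n k =>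
    hm.comp_aemeasurable (aem_of_map (hZ n k))
  have hZm2 : ∀ n k, AEMeasurable (fun ω => ENNReal.ofReal ((1 / 4) ^ n) *
      ENNReal.ofReal (phiO J (Z n k ω ^ 2 / 8))) P := fun n k => (hZm n k).const_mul _
  have hs : ∀ n, AEMeasurable (fun ω => ∑ k ∈ Finset.range (2 ^ n), ENNReal.ofReal ((1 / 4) ^ n) *
      ENNReal.ofReal (phiO J (Z n k ω ^ 2 / 8))) P := fun n =>
    Finset.aemeasurable_fun_sum _ fun k _ => hZm2 n k
  unfold chainS
  refine ⟨AEMeasurable.ennreal_tsum hs, ?_⟩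
  obtain ⟨E, hE⟩ : ∃ E, E = ∫⁻ x, ENNReal.ofReal (phiO J (x ^ 2 / 8)) ∂(ProbabilityTheory.gaussianReal 0 1) := ⟨_, rfl⟩
  have hE1 : E < ⊤ := by rw [hE]; exact gauss_phi J
  have hEZ : ∀ n k, ∫⁻ ω, ENNReal.ofReal (phiO J (Z n k ω ^ 2 / 8)) ∂P = E := by
    intro n k
    rw [hE, ← hZ n k, lintegral_map' hm.aemeasurable (aem_of_map (hZ n k))]
  rw [lintegral_tsum hs]
  have e : ∀ n : ℕ, ∫⁻ ω, ∑ k ∈ Finset.range (2 ^ n), ENNReal.ofReal ((1 / 4) ^ n) *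
      ENNReal.ofReal (phiO J (Z n k ω ^ 2 / 8)) ∂P = E * ENNReal.ofReal ((1 / 2) ^ n) := by
    intro n
    rw [lintegral_finsetSum' _ fun k _ => hZm2 n k]
    simp_rw [lintegral_const_mul'' _ (hZm n _), hEZ]
    rw [Finset.sum_const, Finset.card_range, nsmul_eq_mul]
    have : ENNReal.ofReal ((1 / 2) ^ n) = ((2 ^ n : ℕ) : ℝ≥0∞) * ENNReal.ofReal ((1 / 4) ^ n) := by
      rw [← ENNReal.ofReal_natCast, ← ENNReal.ofReal_mul (by positivity)]
      push_cast
      rw [← mul_pow]; norm_num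
    rw [this]; ring
  simp_rw [e]
  rw [ENNReal.tsum_mul_left, ← ENNReal.ofReal_tsum_of_nonneg (fun n => by positivity)
    (summable_geometric_of_lt_one (by norm_num) (by norm_num))]
  exact ENNReal.mul_lt_top hE1 ENNReal.ofReal_lt_top

lemma fbm_holder {Ω : Type*} [MeasurableSpace Ω] {P : Measure Ω} [IsProbabilityMeasure P] {H θ T : ℝ}
    {B : Ω → ℝ → ℝ} (hθ : 0 < θ) (hθH : θ < H) (hT : 0 < T) (hB : IsFBM P H B) :
    ∃ ε : ℝ, 0 < ε ∧ ∃ G : Ω → ℝ, (∀ᵐ ω ∂P, 0 ≤ G ω ∧ ∀ s ∈ Icc 0 T, ∀ t ∈ Icc 0 T,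
      |B ω t - B ω s| ≤ G ω * |t - s| ^ θ) ∧
      ∫⁻ ω, ENNReal.ofReal (Real.exp (ε * G ω ^ 2)) ∂P < ⊤ := by
  have hH : 0 < H := hθ.trans hθH
  obtain ⟨η, hη⟩ : ∃ η, η = H - θ := ⟨_, rfl⟩
  have hη0 : 0 < η := by rw [hη]; linarith
  obtain ⟨J, hJ⟩ : ∃ J : ℕ, 1 ≤ η * J := by
    obtain ⟨J, hJ⟩ := exists_nat_ge (1 / η)
    refine ⟨J, ?_⟩
    rw [div_le_iff₀ hη0] at hJ
    linarith
  obtain ⟨C, hC0, hC⟩ := dyadic hθ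
  obtain ⟨Z, hZd⟩ : ∃ Z : ℕ → ℕ → Ω → ℝ, ∀ n k, Z n k = fun ω =>
      (T * (((k : ℝ) + 1) / 2 ^ n) - T * ((k : ℝ) / 2 ^ n)) ^ (-H) *
      (B ω (T * (((k : ℝ) + 1) / 2 ^ n)) - B ω (T * ((k : ℝ) / 2 ^ n))) := ⟨fun n k ω =>
      (T * (((k : ℝ) + 1) / 2 ^ n) - T * ((k : ℝ) / 2 ^ n)) ^ (-H) *
      (B ω (T * (((k : ℝ) + 1) / 2 ^ n)) - B ω (T * ((k : ℝ) / 2 ^ n))), fun _ _ => rfl⟩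
  have hZ : ∀ n k, Measure.map (Z n k) P = ProbabilityTheory.gaussianReal 0 1 := by
    intro n k
    rw [hZd]
    refine fbm_incr hH hB (by positivity) ?_
    gcongr
    linarith
  obtain ⟨hSm, hSi⟩ := chain_int J Z hZ
  obtain ⟨S, hS⟩ : ∃ S : Ω → ℝ≥0∞, S = fun ω => chainS J (fun n k => Z n k ω) := ⟨_, rfl⟩
  obtain ⟨q, hq⟩ : ∃ q : Ω → ℝ, q = fun ω => √(8 * Real.log (Real.exp 1 + (S ω).toReal)) := ⟨_, rfl⟩
  obtain ⟨A, hA⟩ : ∃ A, A = C * T ^ H * T ^ (-θ) := ⟨_, rfl⟩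
  have hA0 : 0 ≤ A := by rw [hA]; positivity
  refine ⟨1 / (8 * A ^ 2 + 1), by positivity, fun ω => A * q ω, ?_, ?_⟩
  · filter_upwards [ae_lt_top' hSm hSi.ne, hB.1] with ω hω hcont
    have hq0 : 0 ≤ q ω := by rw [hq]; positivity
    refine ⟨by positivity, ?_⟩
    have h1 := hC (fun s => B ω (T * s)) (T ^ H * q ω) (by fun_prop) (by positivity) (by
      intro n k hk
      have h2 := chain_bound hη0 hJ hω hk
      have h3 : ((2 : ℝ) ^ (-η)) ^ n * |Z n k ω| ≤ q ω := by rw [hq, hS]; exact h2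
      have hΔ : T * ((k + 1) / 2 ^ n) - T * (k / 2 ^ n) = T * (1 / 2) ^ n := by
        rw [one_div_pow]; ring
      have hd : 0 < T * (1 / 2 : ℝ) ^ n := by positivity
      have h4 : B ω (T * ((k + 1) / 2 ^ n)) - B ω (T * (k / 2 ^ n)) = (T * (1 / 2) ^ n) ^ H * Z n k ω := by
        rw [hZd]
        simp only [hΔ]
        rw [← mul_assoc, ← Real.rpow_add hd]
        simp
      simp only [h4]
      rw [abs_mul, abs_of_nonneg (by positivity), Real.mul_rpow hT.le (by positivity)]
      have h5 : ((1 / 2 : ℝ) ^ n) ^ H = ((2 : ℝ) ^ (-η)) ^ n * ((2 : ℝ) ^ (-θ)) ^ n := by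
        rw [← mul_pow, ← Real.rpow_add (by norm_num), ← Real.rpow_natCast, ← Real.rpow_natCast,
          ← Real.rpow_mul (by norm_num), ← Real.rpow_mul (by norm_num), one_div, Real.inv_rpow (by norm_num),
          ← Real.rpow_neg (by norm_num)]
        congr 1
        rw [hη]; ring
      rw [h5]
      calc T ^ H * (((2 : ℝ) ^ (-η)) ^ n * ((2 : ℝ) ^ (-θ)) ^ n) * |Z n k ω| =
          T ^ H * ((2 : ℝ) ^ (-θ)) ^ n * (((2 : ℝ) ^ (-η)) ^ n * |Z n k ω|) := by ring
        _ ≤ T ^ H * ((2 : ℝ) ^ (-θ)) ^ n * q ω := by gcongr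
        _ = _ := by ring)
    intro s hs t ht
    have h2 := h1 (s / T) ⟨div_nonneg hs.1 hT.le, (div_le_one hT).2 hs.2⟩ (t / T)
      ⟨div_nonneg ht.1 hT.le, (div_le_one hT).2 ht.2⟩
    simp only [mul_div_cancel₀ _ hT.ne'] at h2
    refine h2.trans (le_of_eq ?_)
    rw [← sub_div, abs_div, abs_of_pos hT, Real.div_rpow (abs_nonneg _) hT.le, hA, Real.rpow_neg hT.le]
    ring
  · calc _ ≤ ∫⁻ ω, (ENNReal.ofReal (Real.exp 1) + S ω) ∂P := by
          refine lintegral_mono fun ω => ?_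
          have he : 1 ≤ Real.exp 1 + (S ω).toReal := by
            have := Real.one_le_exp (zero_le_one : (0 : ℝ) ≤ 1)
            have h2 : 0 ≤ (S ω).toReal := ENNReal.toReal_nonneg
            linarith
          have hl : 0 ≤ Real.log (Real.exp 1 + (S ω).toReal) := Real.log_nonneg he
          have h1 : Real.exp (1 / (8 * A ^ 2 + 1) * (A * q ω) ^ 2) ≤ Real.exp 1 + (S ω).toReal := by
            rw [← Real.le_log_iff_exp_le (by linarith), mul_pow, hq, Real.sq_sqrt (by positivity)]
            rw [div_mul_eq_mul_div, one_mul, div_le_iff₀ (by positivity)]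
            nlinarith
          refine (ENNReal.ofReal_le_ofReal h1).trans ?_
          rw [ENNReal.ofReal_add (Real.exp_pos _).le ENNReal.toReal_nonneg]
          exact add_le_add_right ENNReal.ofReal_toReal_le _
      _ < ⊤ := by
          rw [lintegral_add_left measurable_const, lintegral_const, measure_univ, mul_one, hS]
          exact ENNReal.add_lt_top.2 ⟨ENNReal.ofReal_lt_top, hSi⟩

/-! ### Conclusion -/

lemma young_aux {γ D C ε : ℝ} (hγ0 : 0 < γ) (hγ : γ < 2) (hD : 0 ≤ D) (hC : 0 ≤ C) (hε : 0 < ε) :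
    ∃ K : ℝ, ∀ G : ℝ, 0 ≤ G → D * (1 + C * (1 + G)) ^ γ ≤ ε * G ^ 2 + K := by
  obtain ⟨δ, hδ⟩ : ∃ δ, δ = ε / (2 * D * C ^ 2 + 1) := ⟨_, rfl⟩
  have hδ0 : 0 < δ := by rw [hδ]; positivity
  have hδ1 : D * δ * (2 * C ^ 2) ≤ ε := by
    have : δ * (2 * D * C ^ 2 + 1) = ε := by rw [hδ]; field_simp
    nlinarith
  obtain ⟨N, hN⟩ : ∃ N, N = (1 / δ) ^ (1 / (2 - γ)) := ⟨_, rfl⟩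
  have hN0 : 0 < N := by rw [hN]; positivity
  have hy : ∀ y : ℝ, 0 < y → y ^ γ ≤ δ * y ^ 2 + N ^ γ := by
    intro y hy0
    rcases le_total y N with h | h
    · have h1 := Real.rpow_le_rpow hy0.le h hγ0.le
      have h2 : 0 ≤ δ * y ^ 2 := by positivity
      linarith
    · have h1 : N ^ (2 - γ) ≤ y ^ (2 - γ) := Real.rpow_le_rpow hN0.le h (by linarith)
      have h2 : N ^ (2 - γ) = 1 / δ := by
        rw [hN, ← Real.rpow_mul (by positivity), one_div_mul_cancel (by linarith), Real.rpow_one]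
      rw [h2, div_le_iff₀ hδ0] at h1
      have h3 : y ^ 2 = y ^ (2 - γ) * y ^ γ := by
        rw [← Real.rpow_add hy0, ← Real.rpow_natCast]; congr 1; push_cast; ring
      have h4 : 0 < y ^ γ := by positivity
      have h5 : 0 < N ^ γ := by positivity
      rw [h3]
      nlinarith
  refine ⟨D * (δ * (2 * (1 + C) ^ 2) + N ^ γ), fun G hG => ?_⟩
  have h1 := hy (1 + C * (1 + G)) (by positivity)
  have h2 : (1 + C * (1 + G)) ^ 2 ≤ 2 * (1 + C) ^ 2 + 2 * C ^ 2 * G ^ 2 := by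
    nlinarith [sq_nonneg (1 + C - C * G)]
  calc D * (1 + C * (1 + G)) ^ γ ≤ D * (δ * (2 * (1 + C) ^ 2 + 2 * C ^ 2 * G ^ 2) + N ^ γ) := by
        refine mul_le_mul_of_nonneg_left (h1.trans ?_) hD
        gcongr
    _ = D * δ * (2 * C ^ 2) * G ^ 2 + D * (δ * (2 * (1 + C) ^ 2) + N ^ γ) := by ring
    _ ≤ _ := by gcongr

theorem moments_pure_fractional_sde {Ω : Type*} [MeasurableSpace Ω]
    (P : Measure Ω) [IsProbabilityMeasure P] (H T M β X0 κ α : ℝ)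
    (B : Ω → ℝ → ℝ) (a c : ℝ → ℝ → ℝ) (X : Ω → ℝ → ℝ)
    (hH : H ∈ Set.Ioo (1 / 2 : ℝ) 1) (hT : 0 < T)
    (hB : IsFBM P H B)
    (hM : 0 < M) (hβ : β ∈ Set.Ioo (1 - H) 1)
    (hgrowth : ∀ t ∈ Set.Icc 0 T, ∀ x : ℝ, |a t x| + |c t x| ≤ M * (1 + |x|))
    (hlip : ∀ t ∈ Set.Icc 0 T, ∀ x y : ℝ,
      |a t x - a t y| + |c t x - c t y| ≤ M * |x - y|)
    (hhold : ∀ s ∈ Set.Icc 0 T, ∀ t ∈ Set.Icc 0 T, ∀ x : ℝ,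
      |a s x - a t x| + |c s x - c t x| ≤ M * |s - t| ^ β)
    (hκ : κ ∈ Set.Ioo (1 - H) 1)
    (hα : α ∈ Set.Ioo (1 - H) (min κ (min β (1 / 2))))
    (hXmeas : ∀ t : ℝ, Measurable fun ω => X ω t)
    (hXholder : ∀ᵐ ω ∂P, ∃ L : ℝ, ∀ s ∈ Set.Icc 0 T, ∀ t ∈ Set.Icc 0 T,
      |X ω t - X ω s| ≤ L * |t - s| ^ κ)
    (hXsol : ∀ᵐ ω ∂P, ∀ t ∈ Set.Icc 0 T,
      X ω t = X0 + (∫ s in Ioo (0 : ℝ) t, a s (X ω s))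
        + glsIntegral α 0 t (fun s => c s (X ω s)) (B ω)) :
    ∀ p : ℝ, 0 < p →
      (∫⁻ ω, (⨆ (t : ℝ) (_ : t ∈ Set.Icc (0 : ℝ) T),
          ENNReal.ofReal |X ω t|) ^ p ∂P) < ⊤ ∧
      (∫⁻ ω, (supNorm α T (X ω)) ^ p ∂P) < ⊤ := by
  obtain ⟨hα1, hα2⟩ := hα
  obtain ⟨hακ, hα3⟩ := lt_min_iff.1 hα2
  obtain ⟨hαβ, hαh⟩ := lt_min_iff.1 hα3
  have hα0 : 0 < α := by linarith [hH.2]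
  intro p hp
  suffices h : (∫⁻ ω, (supNorm α T (X ω)) ^ p ∂P) < ⊤ by
    refine ⟨lt_of_le_of_lt (lintegral_mono fun ω => ?_) h, h⟩
    exact ENNReal.rpow_le_rpow le_self_add hp.le
  obtain ⟨θ, hθ⟩ : ∃ θ, θ = (1 - α + H) / 2 := ⟨_, rfl⟩
  have hθ1 : 1 - α < θ := by rw [hθ]; linarith
  have hθ2 : θ < H := by rw [hθ]; linarith
  obtain ⟨ε, hε, G, hG, hGi⟩ := fbm_holder (by linarith : 0 < θ) hθ2 hT hB
  obtain ⟨C2, hC2, hpath⟩ := path_sup hα0 hαh hθ1 (by linarith [hH.2]) hT hM.le hαβ hακ a c X0 hgrowth hlip hhold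
  have h1α : 0 < 1 - α := by linarith
  obtain ⟨K, hK⟩ := young_aux (γ := 1 / (1 - α)) (D := p * (T + 1)) (C := C2) (ε := ε) (by positivity)
    (by rw [div_lt_iff₀ h1α]; linarith) (by positivity) hC2 hε
  have hA : 0 < 4 * (1 + |X0|) := by positivity
  calc _ ≤ ∫⁻ ω, ENNReal.ofReal ((4 * (1 + |X0|)) ^ p * Real.exp K) *
        ENNReal.ofReal (Real.exp (ε * G ω ^ 2)) ∂P := by
        refine lintegral_mono_ae ?_
        filter_upwards [hG, hXholder, hXsol] with ω ⟨hG0, hGh⟩ ⟨L, hL⟩ hsol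
        have h1 := hpath (X ω) (B ω) (G ω) L hG0 hGh hL hsol
        refine (ENNReal.rpow_le_rpow h1 hp.le).trans ?_
        rw [ENNReal.ofReal_rpow_of_pos (by positivity), ← ENNReal.ofReal_mul (by positivity)]
        apply ENNReal.ofReal_le_ofReal
        rw [Real.mul_rpow hA.le (Real.exp_pos _).le, mul_assoc, ← Real.exp_add, ← Real.exp_mul]
        refine mul_le_mul_of_nonneg_left (Real.exp_le_exp.2 ?_) (by positivity)
        have := hK (G ω) hG0
        linarith
    _ < ⊤ := by
        rw [lintegral_const_mul' _ _ ENNReal.ofReal_ne_top]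
        exact ENNReal.mul_lt_top ENNReal.ofReal_lt_top hGi
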